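/- arXiv:math/0404139 — 3 statements merged into one kernel-verified Lean document; each statement's English description precedes it below -/
import Mathlib

section
/- If 𝔤 is not of type A₁ or A₂ (i.e., 𝔤 ≠ 𝔰𝔩(2), 𝔰𝔩(3)), then the Lie algebra Out(𝔫) = Der(𝔫)/ad(𝔫) is a 2n-dimensional solvable Lie algebra: its derived algebra is contained in the abelian subalgebra spanned by the classes of B₁,…,Bₙ; in particular Out(𝔫) contains no simple subalgebra acting nontrivially (it is two-step solvable). -/
open scoped InnerProductSpace

attribute [local instance 100] LieRing.ofAssociativeRing

/-- The combinatorial data attached to a simple finite-dimensional complex Lie algebra `𝔤`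
of rank `n` with a fixed Cartan subalgebra and a fixed system of simple roots
`α₁, …, αₙ`: a reduced crystallographic *irreducible* root system `R` in a euclidean
space `V`, together with a base `simple : Fin n → V` (the simple roots) and the coordinate
functions `coord`, recording for each positive root `α = Σᵢ Aᵢ(α) αᵢ` the tuple
`(A₁(α), …, Aₙ(α))` of its coordinates with respect to the simple roots. -/
structure RootSystemBase (n : ℕ) (V : Type*) [NormedAddCommGroup V]
    [InnerProductSpace ℝ V] : Type _ where
  /-- The (finite) set of roots. -/
  R : Finset V
  zero_not_mem : (0 : V) ∉ R
  span_eq_top : Submodule.span ℝ (R : Set V) = ⊤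
  reduced : ∀ α ∈ R, ∀ c : ℝ, c • α ∈ R → c = 1 ∨ c = -1
  crystallographic : ∀ α ∈ R, ∀ β ∈ R, ∃ k : ℤ, (k : ℝ) = 2 * ⟪β, α⟫_ℝ / ⟪α, α⟫_ℝ
  reflect_mem : ∀ α ∈ R, ∀ β ∈ R, β - (2 * ⟪β, α⟫_ℝ / ⟪α, α⟫_ℝ) • α ∈ R
  /-- irreducibility: `R` is not the union of two nonempty orthogonal subsets;
  equivalently `𝔤` is simple rather than merely semisimple. -/
  irreducible : ∀ S : Finset V, S ⊆ R → (∀ α ∈ S, ∀ β ∈ R, β ∉ S → ⟪α, β⟫_ℝ = 0) →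
    S = ∅ ∨ S = R
  /-- The simple roots `α₁, …, αₙ`. -/
  simple : Fin n → V
  simple_mem : ∀ i, simple i ∈ R
  simple_linearIndependent : LinearIndependent ℝ simple
  /-- `coord β i` is the coefficient `Aᵢ(β)` of `β` in the basis of simple roots. -/
  coord : V → Fin n → ℤ
  root_eq_sum : ∀ β ∈ R, β = ∑ i, (coord β i : ℝ) • simple i
  coord_sign : ∀ β ∈ R, (∀ i, 0 ≤ coord β i) ∨ (∀ i, coord β i ≤ 0)

namespace RootSystemBase

variable {n : ℕ} {V : Type*} [NormedAddCommGroup V] [InnerProductSpace ℝ V]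
variable (Φ : RootSystemBase n V)

/-- `β` is a positive root. -/
def IsPos (β : V) : Prop := β ∈ Φ.R ∧ ∀ i, 0 ≤ Φ.coord β i

/-- The level `l(β) = Σᵢ Aᵢ(β)` of a root `β`. -/
def level (β : V) : ℤ := ∑ i, Φ.coord β i

/-- `μ` is the highest root. -/
def IsHighest (μ : V) : Prop :=
  Φ.IsPos μ ∧ ∀ β, Φ.IsPos β → ∀ i, Φ.coord β i ≤ Φ.coord μ i

end RootSystemBase

/-- A linear map `T : 𝔫 → 𝔫` is a derivation of the Lie algebra `𝔫`. -/
def IsLieDerivation {L : Type*} [LieRing L] [LieAlgebra ℂ L] (T : Module.End ℂ L) : Prop :=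
  ∀ x y : L, T ⁅x, y⁆ = ⁅T x, y⁆ + ⁅x, T y⁆

/-- The inner derivations `ad x`, `x ∈ 𝔫`, as a subspace of `End(𝔫)`. -/
noncomputable def innerDerivations (L : Type*) [LieRing L] [LieAlgebra ℂ L] :
    Submodule ℂ (Module.End ℂ L) :=
  LinearMap.range (LieAlgebra.ad ℂ L).toLinearMap

/-- The derivations of `𝔫`, as a subspace of `End(𝔫)`. -/
noncomputable def derivations (L : Type*) [LieRing L] [LieAlgebra ℂ L] :
    Submodule ℂ (Module.End ℂ L) where
  carrier := {T | IsLieDerivation T}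
  add_mem' := by
    intro S T hS hT x y
    simp only [LinearMap.add_apply, hS x y, hT x y, add_lie, lie_add]
    abel
  zero_mem' := by intro x y; simp
  smul_mem' := by
    intro c T hT x y
    simp only [LinearMap.smul_apply, hT x y, smul_lie, lie_smul, smul_add]

/-- A Chevalley-basis presentation of the maximal nilpotent subalgebra
`𝔫 = ⊕_{α ∈ R⁺} 𝔤_α` of a simple finite-dimensional complex Lie algebra `𝔤` with root
system `Φ`: a complex Lie algebra `𝔫` together with a basis `e` of root vectors indexed
by the positive roots, such that `⁅e_α, e_β⁆ = N_{αβ} • e_{α+β}` when `α+β ∈ R⁺` and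
`⁅e_α, e_β⁆ = 0` otherwise, where the structure constants `N_{αβ}` of the Chevalley basis
are nonzero whenever `α + β` is a root. -/
structure ChevalleyNilradical {n : ℕ} {V : Type*} [NormedAddCommGroup V]
    [InnerProductSpace ℝ V] (Φ : RootSystemBase n V)
    (L : Type*) [LieRing L] [LieAlgebra ℂ L] where
  /-- the root vectors `e_α`, `α ∈ R⁺`, a basis of `𝔫` -/
  e : Module.Basis {β : V // Φ.IsPos β} ℂ L
  /-- the structure constants -/
  N : V → V → ℂ
  lie_eq : ∀ (α β : {β : V // Φ.IsPos β}) (h : Φ.IsPos (α.1 + β.1)),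
    ⁅e α, e β⁆ = N α.1 β.1 • e ⟨α.1 + β.1, h⟩
  lie_eq_zero : ∀ α β : {β : V // Φ.IsPos β}, ¬ Φ.IsPos (α.1 + β.1) → ⁅e α, e β⁆ = 0
  N_ne_zero : ∀ α β : {β : V // Φ.IsPos β}, Φ.IsPos (α.1 + β.1) → N α.1 β.1 ≠ 0

namespace ChevalleyNilradical

variable {n : ℕ} {V : Type*} [NormedAddCommGroup V] [InnerProductSpace ℝ V]
  {Φ : RootSystemBase n V} {L : Type*} [LieRing L] [LieAlgebra ℂ L]
  (C : ChevalleyNilradical Φ L)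

/-- The weight-zero cocycle (derivation) `Dᵢ = cᵢ : e_α ↦ Aᵢ(α) e_α`. -/
noncomputable def D (i : Fin n) : Module.End ℂ L :=
  C.e.constr ℂ fun β => (Φ.coord β.1 i : ℂ) • C.e β

/-- The cocycle (derivation) `Bᵢ = bᵢ = e_{γᵢ} ⊗ f^{αᵢ}`, sending `e_{αᵢ} ↦ e_{γᵢ}` where
`γᵢ = μ − mᵢ αᵢ`, and killing `e_β` for every positive root `β ≠ αᵢ`. -/
noncomputable def B (μ : V) (m : Fin n → ℕ)
    (hγ : ∀ i, Φ.IsPos (μ - m i • Φ.simple i)) (i : Fin n) : Module.End ℂ L :=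
  letI := Classical.decEq V
  C.e.constr ℂ fun β => if β.1 = Φ.simple i then C.e ⟨μ - m i • Φ.simple i, hγ i⟩ else 0

end ChevalleyNilradical

namespace RootSystemBase

variable {n : ℕ} {V : Type*} [NormedAddCommGroup V] [InnerProductSpace ℝ V]
variable (Φ : RootSystemBase n V)

/-- The simple roots, as a basis of the ambient space. -/
noncomputable def simpleBasis : Module.Basis (Fin n) ℝ V :=
  Module.Basis.mk Φ.simple_linearIndependent <| by
    rw [← Φ.span_eq_top, Submodule.span_le]
    intro β hβ
    rw [Φ.root_eq_sum β hβ]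
    exact Submodule.sum_mem _ fun i _ =>
      Submodule.smul_mem _ _ (Submodule.subset_span ⟨i, rfl⟩)

/-- The coefficient of a vector along the `i`-th simple root, as a linear form. -/
noncomputable def coeff (i : Fin n) : V →ₗ[ℝ] ℝ := Φ.simpleBasis.coord i

lemma coeff_simple (i j : Fin n) : Φ.coeff i (Φ.simple j) = if j = i then 1 else 0 := by
  have h : Φ.simpleBasis j = Φ.simple j := by simp [simpleBasis]
  rw [coeff, ← h, Module.Basis.coord_apply, Module.Basis.repr_self, Finsupp.single_apply]

lemma sum_coeff (v : V) : ∑ i, Φ.coeff i v • Φ.simple i = v := by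
  have := Φ.simpleBasis.sum_repr v
  simpa [coeff, simpleBasis] using this

lemma coeff_ext {v w : V} (h : ∀ i, Φ.coeff i v = Φ.coeff i w) : v = w := by
  rw [← Φ.sum_coeff v, ← Φ.sum_coeff w]
  simp [h]

variable {Φ}

lemma coeff_simple_self (i : Fin n) : Φ.coeff i (Φ.simple i) = 1 := by simp [coeff_simple]

lemma coeff_simple_of_ne {i j : Fin n} (h : i ≠ j) : Φ.coeff i (Φ.simple j) = 0 := by
  simp [coeff_simple, h.symm]

lemma coeff_root {β : V} (hβ : β ∈ Φ.R) (i : Fin n) : Φ.coeff i β = Φ.coord β i := by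
  conv_lhs => rw [Φ.root_eq_sum β hβ]
  simp [coeff_simple]

lemma IsPos.coeff_nonneg {β : V} (h : Φ.IsPos β) (i : Fin n) : 0 ≤ Φ.coeff i β := by
  rw [coeff_root h.1]; exact_mod_cast h.2 i

lemma isPos_of_coeff_nonneg {β : V} (h : β ∈ Φ.R) (h' : ∀ i, 0 ≤ Φ.coeff i β) : Φ.IsPos β :=
  ⟨h, fun i => by have := h' i; rw [coeff_root h] at this; exact_mod_cast this⟩

lemma ne_zero_of_mem {β : V} (h : β ∈ Φ.R) : β ≠ 0 := fun h0 => Φ.zero_not_mem (h0 ▸ h)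

lemma inner_self_pos {β : V} (h : β ∈ Φ.R) : 0 < ⟪β, β⟫_ℝ :=
  real_inner_self_pos.2 (ne_zero_of_mem h)

lemma isPos_of_coeff_pos {β : V} (h : β ∈ Φ.R) {i : Fin n} (hi : 0 < Φ.coeff i β) :
    Φ.IsPos β := by
  refine ⟨h, (Φ.coord_sign β h).resolve_right fun h' => ?_⟩
  rw [coeff_root h] at hi
  have := h' i
  have : 0 < Φ.coord β i := by exact_mod_cast hi
  omega

lemma IsPos.exists_coeff_pos {β : V} (h : Φ.IsPos β) : ∃ i, 0 < Φ.coeff i β := by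
  by_contra! h'
  refine ne_zero_of_mem h.1 (Φ.coeff_ext fun i => ?_)
  rw [map_zero]
  exact le_antisymm (h' i) (h.coeff_nonneg i)

lemma IsPos.one_le_coeff {β : V} (h : Φ.IsPos β) {i : Fin n} (hi : 0 < Φ.coeff i β) :
    1 ≤ Φ.coeff i β := by
  rw [coeff_root h.1] at hi ⊢
  have : 0 < Φ.coord β i := by exact_mod_cast hi
  exact_mod_cast this

lemma isPos_simple (i : Fin n) : Φ.IsPos (Φ.simple i) :=
  isPos_of_coeff_pos (i := i) (Φ.simple_mem i) (by simp [coeff_simple])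

lemma neg_mem {β : V} (h : β ∈ Φ.R) : -β ∈ Φ.R := by
  have := Φ.reflect_mem β h β h
  rw [mul_div_assoc, div_self (inner_self_pos h).ne'] at this
  convert this using 1
  module

lemma not_isPos_neg {β : V} (h : Φ.IsPos β) : ¬ Φ.IsPos (-β) := by
  intro h'
  obtain ⟨i, hi⟩ := h.exists_coeff_pos
  have := h'.coeff_nonneg i
  rw [map_neg] at this
  linarith

/-- The pairing `⟨v, α^∨⟩ = 2 ⟪v, α⟫ / ⟪α, α⟫`. -/
noncomputable def pairing (α v : V) : ℝ := 2 * ⟪v, α⟫_ℝ / ⟪α, α⟫_ℝ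

lemma pairing_self {α : V} (h : α ∈ Φ.R) : pairing α α = 2 := by
  rw [pairing, mul_div_assoc, div_self (inner_self_pos h).ne', mul_one]

lemma pairing_add (α v w : V) : pairing α (v + w) = pairing α v + pairing α w := by
  simp only [pairing, inner_add_left]; ring

lemma pairing_sub (α v w : V) : pairing α (v - w) = pairing α v - pairing α w := by
  simp only [pairing, inner_sub_left]; ring

lemma pairing_smul (α v : V) (c : ℝ) : pairing α (c • v) = c * pairing α v := by
  simp only [pairing, real_inner_smul_left]; ring

lemma pairing_pos_iff {α : V} (h : α ∈ Φ.R) {v : V} : 0 < pairing α v ↔ 0 < ⟪v, α⟫_ℝ := by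
  rw [pairing, div_pos_iff_of_pos_right (inner_self_pos h)]
  constructor <;> intro <;> linarith

lemma pairing_neg_iff {α : V} (h : α ∈ Φ.R) {v : V} : pairing α v < 0 ↔ ⟪v, α⟫_ℝ < 0 := by
  rw [← neg_pos, ← neg_pos (a := ⟪v, α⟫_ℝ), ← inner_neg_left, ← pairing_pos_iff h, pairing, pairing,
    inner_neg_left]
  ring_nf

lemma exists_int_pairing {α β : V} (hα : α ∈ Φ.R) (hβ : β ∈ Φ.R) :
    ∃ k : ℤ, pairing α β = k := by
  obtain ⟨k, hk⟩ := Φ.crystallographic α hα β hβ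
  exact ⟨k, hk.symm⟩

lemma sub_pairing_smul_mem {α β : V} (hα : α ∈ Φ.R) (hβ : β ∈ Φ.R) :
    β - pairing α β • α ∈ Φ.R := Φ.reflect_mem α hα β hβ

lemma sub_mem {α β : V} (hα : α ∈ Φ.R) (hβ : β ∈ Φ.R) (h : 0 < ⟪α, β⟫_ℝ) (hne : α ≠ β) :
    α - β ∈ Φ.R := by
  obtain ⟨k, hk⟩ := exists_int_pairing hβ hα
  obtain ⟨l, hl⟩ := exists_int_pairing hα hβ
  have hk0 : 0 < k := by
    have := (pairing_pos_iff hβ).2 h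
    rw [hk] at this; exact_mod_cast this
  have hl0 : 0 < l := by
    have := (pairing_pos_iff (v := β) hα).2 (by rwa [real_inner_comm])
    rw [hl] at this; exact_mod_cast this
  by_cases hk1 : k = 1
  · have := sub_pairing_smul_mem hβ hα
    rwa [hk, hk1, Int.cast_one, one_smul] at this
  by_cases hl1 : l = 1
  · have := sub_pairing_smul_mem hα hβ
    rw [hl, hl1, Int.cast_one, one_smul] at this
    rw [← neg_sub]; exact neg_mem this
  exfalso
  have hk2 : (2 : ℝ) ≤ k := by exact_mod_cast (by omega : 2 ≤ k)
  have hl2 : (2 : ℝ) ≤ l := by exact_mod_cast (by omega : 2 ≤ l)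
  rw [← hk, pairing, le_div_iff₀ (inner_self_pos hβ)] at hk2
  rw [← hl, pairing, le_div_iff₀ (inner_self_pos hα), real_inner_comm] at hl2
  have h0 : ⟪α - β, α - β⟫_ℝ ≤ 0 := by
    rw [real_inner_sub_sub_self]
    have := real_inner_comm α β
    linarith
  exact hne (sub_eq_zero.1 (real_inner_self_nonpos.1 h0))

lemma add_mem {α β : V} (hα : α ∈ Φ.R) (hβ : β ∈ Φ.R) (h : ⟪α, β⟫_ℝ < 0) (hne : α + β ≠ 0) :
    α + β ∈ Φ.R := by
  have := sub_mem hα (neg_mem hβ) (by rw [inner_neg_right]; linarith)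
    (fun h => hne (by rw [h]; simp))
  rwa [sub_neg_eq_add] at this

lemma sub_mem_of_sub_smul_mem {α β : V} (hα : α ∈ Φ.R) (hβ : β ∈ Φ.R)
    (h0 : ∀ c : ℝ, β ≠ c • α) {k : ℕ} (hk : β - ((k : ℝ) + 1) • α ∈ Φ.R) : β - α ∈ Φ.R := by
  by_cases hp : 0 < ⟪β, α⟫_ℝ
  · exact sub_mem hβ hα hp (fun h => h0 1 (by simpa using h))
  induction k with
  | zero => simpa using hk
  | succ k ih =>
    refine ih ?_
    have hr : β - ((k : ℝ) + 1) • α = β - (((k + 1 : ℕ) : ℝ) + 1) • α + α := by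
      push_cast; module
    rw [hr]
    refine add_mem hk hα ?_ ?_
    · rw [inner_sub_left, real_inner_smul_left]
      have := inner_self_pos hα
      have : 0 < (((k + 1 : ℕ) : ℝ) + 1) * ⟪α, α⟫_ℝ := by positivity
      linarith
    · rw [← hr, sub_ne_zero]
      exact h0 _

/-- The length of the part of the `α`-string through `β` lying below `β`. -/
noncomputable def depth (Φ : RootSystemBase n V) (α β : V) : ℕ :=
  sSup {k : ℕ | β - (k : ℝ) • α ∈ Φ.R}

lemma bddAbove_depth {α : V} (hα : α ∈ Φ.R) (β : V) :
    BddAbove {k : ℕ | β - (k : ℝ) • α ∈ Φ.R} := by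
  refine (Set.Finite.preimage (f := fun k : ℕ => β - (k : ℝ) • α) ?_ Φ.R.finite_toSet).bddAbove
  intro a _ b _ hab
  have : (a : ℝ) • α = (b : ℝ) • α := by simpa using hab
  exact_mod_cast smul_left_injective ℝ (ne_zero_of_mem hα) this

lemma sub_depth_mem {α β : V} (hα : α ∈ Φ.R) (hβ : β ∈ Φ.R) :
    β - (Φ.depth α β : ℝ) • α ∈ Φ.R :=
  Nat.sSup_mem (s := {k : ℕ | β - (k : ℝ) • α ∈ Φ.R}) ⟨0, by simpa using hβ⟩
    (bddAbove_depth hα β)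

lemma le_depth {α β : V} (hα : α ∈ Φ.R) {k : ℕ} (h : β - (k : ℝ) • α ∈ Φ.R) :
    k ≤ Φ.depth α β :=
  le_csSup (bddAbove_depth hα β) h

lemma depth_eq_zero {α β : V} (hα : α ∈ Φ.R) (hβ : β ∈ Φ.R) (h0 : ∀ c : ℝ, β ≠ c • α)
    (h : β - α ∉ Φ.R) : Φ.depth α β = 0 := by
  by_contra hd
  obtain ⟨k, hk⟩ := Nat.exists_eq_succ_of_ne_zero hd
  have := sub_depth_mem hα hβ
  rw [hk] at this
  exact h (sub_mem_of_sub_smul_mem hα hβ h0 (k := k) (by exact_mod_cast this))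

lemma depth_add {α β : V} (hα : α ∈ Φ.R) (hβ : β ∈ Φ.R) (h : β + α ∈ Φ.R) :
    Φ.depth α (β + α) = Φ.depth α β + 1 := by
  apply le_antisymm
  · rcases hd : Φ.depth α (β + α) with _ | k
    · omega
    · have h1 := sub_depth_mem hα h
      rw [hd] at h1
      have : β - (k : ℝ) • α ∈ Φ.R := by
        convert h1 using 1; push_cast; module
      have := le_depth hα this
      omega
  · refine le_depth hα ?_
    convert sub_depth_mem hα hβ using 1
    push_cast; module

lemma depth_sub_depth {α β : V} (hα : α ∈ Φ.R) (hβ : β ∈ Φ.R) :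
    (Φ.depth α β : ℝ) - Φ.depth (-α) β = pairing α β := by
  have hα' := neg_mem hα
  obtain ⟨p, hp⟩ := exists_int_pairing hα hβ
  have h1 := sub_pairing_smul_mem hα (sub_depth_mem hα hβ)
  have h2 := sub_pairing_smul_mem hα (sub_depth_mem hα' hβ)
  rw [pairing_sub, pairing_smul, pairing_self hα, hp] at h1
  rw [smul_neg, sub_neg_eq_add, pairing_add, pairing_smul, pairing_self hα, hp] at h2
  set P := Φ.depth α β
  set Q := Φ.depth (-α) β
  rw [hp]
  have e1 : (P : ℤ) - p ≤ Q := by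
    rcases le_total ((P : ℤ) - p) 0 with h | h
    · omega
    · obtain ⟨k, hk⟩ := Int.eq_ofNat_of_zero_le h
      have : k ≤ Q := by
        refine le_depth hα' ?_
        convert h1 using 1
        have : (k : ℝ) = P - p := by exact_mod_cast hk.symm
        rw [this]; module
      omega
  have e2 : (Q : ℤ) + p ≤ P := by
    rcases le_total ((Q : ℤ) + p) 0 with h | h
    · omega
    · obtain ⟨k, hk⟩ := Int.eq_ofNat_of_zero_le h
      have : k ≤ P := by
        refine le_depth hα ?_
        convert h2 using 1
        have : (k : ℝ) = Q + p := by exact_mod_cast hk.symm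
        rw [this]; module
      omega
  have : (P : ℤ) - Q = p := by omega
  exact_mod_cast this

lemma IsPos.exists_coeff_pos_of_ne {β : V} (h : Φ.IsPos β) {i : Fin n} (hne : β ≠ Φ.simple i) :
    ∃ j, j ≠ i ∧ 0 < Φ.coeff j β := by
  by_contra! h'
  have h0 : β = Φ.coeff i β • Φ.simple i := by
    refine Φ.coeff_ext fun j => ?_
    by_cases hj : j = i
    · subst hj; simp [coeff_simple]
    · rw [map_smul, coeff_simple_of_ne hj, smul_zero]
      exact le_antisymm (h' j hj) (h.coeff_nonneg j)
  have hp := h.coeff_nonneg i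
  rcases Φ.reduced _ (Φ.simple_mem i) (Φ.coeff i β) (h0 ▸ h.1) with h1 | h1
  · rw [h1, one_smul] at h0; exact hne h0
  · linarith

lemma ne_simple_of_coeff_pos {β : V} {i j : Fin n} (hj : j ≠ i) (h : 0 < Φ.coeff j β) :
    ∀ c : ℝ, β ≠ c • Φ.simple i := by
  rintro c rfl
  simp [coeff_simple_of_ne hj] at h

lemma IsPos.ne_smul {β : V} (h : Φ.IsPos β) {i : Fin n} (hne : β ≠ Φ.simple i) (c : ℝ) :
    β ≠ c • Φ.simple i := by
  obtain ⟨j, hj, h⟩ := h.exists_coeff_pos_of_ne hne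
  exact ne_simple_of_coeff_pos hj h c

lemma IsPos.add_smul {β : V} (h : Φ.IsPos β) {i : Fin n} (hne : β ≠ Φ.simple i) {c : ℝ}
    (hc : β + c • Φ.simple i ∈ Φ.R) :
    Φ.IsPos (β + c • Φ.simple i) ∧ β + c • Φ.simple i ≠ Φ.simple i := by
  obtain ⟨j, hj, h⟩ := h.exists_coeff_pos_of_ne hne
  have h' : 0 < Φ.coeff j (β + c • Φ.simple i) := by simpa [coeff_simple_of_ne hj] using h
  exact ⟨isPos_of_coeff_pos hc h', by simpa using ne_simple_of_coeff_pos hj h' 1⟩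

lemma IsPos.add {α β : V} (hα : Φ.IsPos α) (hβ : Φ.IsPos β) (h : α + β ∈ Φ.R) :
    Φ.IsPos (α + β) :=
  isPos_of_coeff_nonneg h fun i => by
    rw [map_add]; exact add_nonneg (hα.coeff_nonneg i) (hβ.coeff_nonneg i)

lemma IsPos.add_ne_simple {α β : V} (hα : Φ.IsPos α) (hβ : Φ.IsPos β) (i : Fin n) :
    α + β ≠ Φ.simple i := by
  intro h
  have key : ∀ γ δ, Φ.IsPos γ → Φ.IsPos δ → γ + δ = Φ.simple i → 1 ≤ Φ.coeff i γ := by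
    intro γ δ hγ hδ h
    obtain ⟨j, hj⟩ := hγ.exists_coeff_pos
    by_cases hji : j = i
    · exact hji ▸ hγ.one_le_coeff hj
    · have := congrArg (Φ.coeff j) h
      rw [map_add, coeff_simple_of_ne hji] at this
      linarith [hδ.coeff_nonneg j]
  have h1 := key α β hα hβ h
  have h2 := key β α hβ hα (by rw [add_comm]; exact h)
  have := congrArg (Φ.coeff i) h
  rw [map_add, coeff_simple_self] at this
  linarith

/-- A positive root which is not simple stays positive after subtracting some simple root. -/
lemma IsPos.exists_isPos_sub_simple {β : V} (h : Φ.IsPos β) (hne : ∀ i, β ≠ Φ.simple i) :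
    ∃ i, Φ.IsPos (β - Φ.simple i) := by
  have h0 := inner_self_pos h.1
  have h1 : ⟪β, β⟫_ℝ = ∑ i, Φ.coeff i β * ⟪β, Φ.simple i⟫_ℝ := by
    conv_lhs => arg 3; rw [← Φ.sum_coeff β]
    rw [inner_sum]
    exact Finset.sum_congr rfl fun i _ => by rw [real_inner_smul_right]
  rw [h1] at h0
  obtain ⟨i, -, hi⟩ := Finset.exists_lt_of_sum_lt (s := Finset.univ) (f := fun _ : Fin n => (0 : ℝ))
    (g := fun i => Φ.coeff i β * ⟪β, Φ.simple i⟫_ℝ) (by simpa using h0)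
  have hi' : 0 < ⟪β, Φ.simple i⟫_ℝ := pos_of_mul_pos_right hi (h.coeff_nonneg i)
  have hm := sub_mem h.1 (Φ.simple_mem i) hi' (hne i)
  have he : β - Φ.simple i = β + (-1 : ℝ) • Φ.simple i := by module
  exact ⟨i, he ▸ (h.add_smul (hne i) (he ▸ hm)).1⟩

lemma simple_sub_simple_not_mem {i j : Fin n} (h : i ≠ j) : Φ.simple i - Φ.simple j ∉ Φ.R := by
  intro hm
  have hp := isPos_of_coeff_pos (i := i) hm (by simp [coeff_simple_of_ne h, coeff_simple_self])
  have := hp.coeff_nonneg j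
  rw [map_sub, coeff_simple_self, coeff_simple_of_ne h.symm] at this
  linarith

/-- A dominant root can be raised by at most one simple root. -/
lemma eq_of_add_simple_mem {ω : V} (hω : ω ∈ Φ.R) (hdom : ∀ i, 0 ≤ ⟪ω, Φ.simple i⟫_ℝ)
    {i j : Fin n} (hi : ω + Φ.simple i ∈ Φ.R) (hj : ω + Φ.simple j ∈ Φ.R) : i = j := by
  by_contra hij
  have key : ∀ k, ω + Φ.simple k ∈ Φ.R → ⟪Φ.simple k, Φ.simple k⟫_ℝ ≤ ⟪ω, ω⟫_ℝ := by
    intro k hk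
    obtain ⟨l, hl⟩ := exists_int_pairing hk hω
    have h0 := inner_self_pos hω
    have h1 := inner_self_pos hk
    have h2 := hdom k
    have hp : 0 < pairing (ω + Φ.simple k) ω := by
      rw [pairing_pos_iff hk, inner_add_right]; linarith
    have hl1 : (1 : ℝ) ≤ l := by
      rw [hl] at hp
      have : 0 < l := by exact_mod_cast hp
      exact_mod_cast this
    rw [← hl, pairing, le_div_iff₀ h1] at hl1
    simp only [inner_add_left, inner_add_right] at hl1
    have := real_inner_comm (Φ.simple k) ω
    linarith
  have h1 := key i hi
  have h2 := key j hj
  have h3 : ⟪ω + Φ.simple i, ω + Φ.simple j⟫_ℝ ≤ 0 := by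
    by_contra! h
    refine simple_sub_simple_not_mem (Φ := Φ) hij ?_
    have := sub_mem hi hj h (fun h => hij (Φ.simple_linearIndependent.injective (by simpa using h)))
    simpa using this
  rw [inner_add_left, inner_add_right, inner_add_right] at h3
  have h4 : 0 < ⟪Φ.simple i + Φ.simple j, Φ.simple i + Φ.simple j⟫_ℝ := by
    refine real_inner_self_pos.2 fun h => ?_
    have := congrArg (Φ.coeff i) h
    simp [coeff_simple_self, coeff_simple_of_ne hij] at this
  rw [real_inner_add_add_self] at h4
  have h5 := real_inner_comm (Φ.simple i) ω
  have h6 := hdom i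
  have h7 := hdom j
  linarith

lemma IsHighest.coeff_le {μ : V} (hμ : Φ.IsHighest μ) {β : V} (h : Φ.IsPos β) (i : Fin n) :
    Φ.coeff i β ≤ Φ.coeff i μ := by
  rw [coeff_root h.1, coeff_root hμ.1.1]; exact_mod_cast hμ.2 β h i

lemma IsHighest.one_le_coeff {μ : V} (hμ : Φ.IsHighest μ) (i : Fin n) : 1 ≤ Φ.coeff i μ := by
  have := hμ.coeff_le (isPos_simple i) i
  rwa [coeff_simple_self] at this

/-- A positive root to which no positive root can be added is the highest root. -/
lemma IsHighest.eq_of_add_not_isPos {μ : V} (hμ : Φ.IsHighest μ) {θ : V} (h : Φ.IsPos θ)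
    (hc : ∀ ν, Φ.IsPos ν → ¬ Φ.IsPos (θ + ν)) : θ = μ := by
  by_contra hne
  have hdom : ∀ i, 0 ≤ ⟪θ, Φ.simple i⟫_ℝ := by
    intro i
    by_contra! hi
    have hm := add_mem h.1 (Φ.simple_mem i) hi fun h0 =>
      not_isPos_neg (isPos_simple i) (eq_neg_of_add_eq_zero_left h0 ▸ h)
    exact hc _ (isPos_simple i) (h.add (isPos_simple i) hm)
  have h1 : 0 ≤ ⟪θ, μ - θ⟫_ℝ := by
    rw [← Φ.sum_coeff (μ - θ), inner_sum]
    refine Finset.sum_nonneg fun i _ => ?_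
    rw [real_inner_smul_right, map_sub]
    exact mul_nonneg (sub_nonneg.2 (hμ.coeff_le h i)) (hdom i)
  rw [inner_sub_right] at h1
  have h2 := inner_self_pos h.1
  have hm := sub_mem hμ.1.1 h.1 (by rw [real_inner_comm]; linarith) (Ne.symm hne)
  have hp : Φ.IsPos (μ - θ) := isPos_of_coeff_nonneg hm fun i => by
    rw [map_sub]; exact sub_nonneg.2 (hμ.coeff_le h i)
  exact hc _ hp (by rw [add_sub_cancel]; exact hμ.1)

end RootSystemBase

section Sl2

variable {M : Type*} [AddCommGroup M] [Module ℂ M] {e f h : Module.End ℂ M}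

private lemma weight_pow_raise (hhe : ∀ m, h (e m) = e (h m) + (2 : ℂ) • e m) {t : M} {a : ℂ}
    (ht : h t = a • t) (j : ℕ) : h ((e ^ j) t) = (a + 2 * j) • (e ^ j) t := by
  induction j with
  | zero => simp [ht]
  | succ j ih =>
    rw [pow_succ', Module.End.mul_apply, hhe, ih, map_smul]
    push_cast
    module

private lemma raise_pow_lower_raise (hef : ∀ m, e (f m) = f (e m) + h m)
    (hhe : ∀ m, h (e m) = e (h m) + (2 : ℂ) • e m) {t : M} {a : ℂ}
    (ht : h t = a • t) (j : ℕ) :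
    (e ^ j) (f (e t)) = f ((e ^ (j + 1)) t) + ((j : ℂ) * (a + j + 1)) • (e ^ j) t := by
  induction j with
  | zero => simp
  | succ j ih =>
    have hs : ∀ (l : ℕ) (s : M), e ((e ^ l) s) = (e ^ (l + 1)) s := fun l s => by
      rw [pow_succ', Module.End.mul_apply]
    rw [← hs, ih, map_add, hef, weight_pow_raise hhe ht, map_smul, hs, hs]
    push_cast
    module

private lemma weight_pow_lower (hhf : ∀ m, h (f m) = f (h m) - (2 : ℂ) • f m) {t : M} {a : ℂ}
    (ht : h t = a • t) (j : ℕ) : h ((f ^ j) t) = (a - 2 * j) • (f ^ j) t := by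
  induction j with
  | zero => simp [ht]
  | succ j ih =>
    rw [pow_succ', Module.End.mul_apply, hhf, ih, map_smul]
    push_cast
    module

/-- In a finite-dimensional representation of `𝔰𝔩(2)`, the `k`-th power of the raising operator
is injective on weight spaces of weight at most `-k`. -/
lemma eq_zero_of_pow_raise_eq_zero [Module.Finite ℂ M]
    (hef : ∀ m, e (f m) = f (e m) + h m)
    (hhe : ∀ m, h (e m) = e (h m) + (2 : ℂ) • e m)
    (hhf : ∀ m, h (f m) = f (h m) - (2 : ℂ) • f m)
    (k : ℕ) (a : ℤ) (ha : a ≤ -k) (t : M) (ht : h t = (a : ℂ) • t) (hk : (e ^ k) t = 0) :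
    t = 0 := by
  induction k generalizing t with
  | zero => simpa using hk
  | succ k ih =>
    by_contra ht0
    have hc := raise_pow_lower_raise hef hhe ht k
    rw [hk, map_zero, zero_add] at hc
    have hft : f (e t) = ((k : ℂ) * (a + k + 1)) • t := by
      rw [← sub_eq_zero]
      refine ih (by push_cast at ha; linarith) _ ?_ ?_
      · simp only [map_sub, hhf, hhe, map_smul, ht, map_add]
        module
      · rw [map_sub, hc, map_smul, sub_self]
    have key : ∀ j : ℕ, ∃ c : ℤ, c < 0 ∧ e ((f ^ (j + 1)) t) = (c : ℂ) • (f ^ j) t := by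
      intro j
      induction j with
      | zero =>
        refine ⟨k * (a + k + 1) + a, ?_, ?_⟩
        · push_cast at ha
          nlinarith [mul_nonneg (Int.natCast_nonneg k) (by linarith : 0 ≤ -(a + k + 1))]
        · rw [zero_add, pow_one, hef, hft, ht, pow_zero, Module.End.one_apply]
          push_cast
          module
      | succ j ihj =>
        obtain ⟨c, hc0, hcj⟩ := ihj
        refine ⟨c + (a - 2 * (j + 1)), ?_, ?_⟩
        · push_cast at ha
          linarith [Int.natCast_nonneg k, Int.natCast_nonneg j]
        · rw [pow_succ', Module.End.mul_apply, hef, hcj, map_smul, weight_pow_lower hhf ht,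
            ← Module.End.mul_apply, ← pow_succ']
          push_cast
          module
    have hne : ∀ j : ℕ, (f ^ j) t ≠ 0 := by
      intro j
      induction j with
      | zero => simpa using ht0
      | succ j ihj =>
        intro h0
        obtain ⟨c, hc0, hcj⟩ := key j
        rw [h0, map_zero] at hcj
        rcases smul_eq_zero.1 hcj.symm with h1 | h1
        · exact hc0.ne (by exact_mod_cast h1)
        · exact ihj h1
    refine Module.Finite.not_linearIndependent_of_infinite (R := ℂ) (fun j : ℕ => (f ^ j) t)
      (Module.End.eigenvectors_linearIndependent' h (fun j : ℕ => (a : ℂ) - 2 * j) ?_ _ fun j =>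
        ⟨Module.End.mem_eigenspace_iff.2 (weight_pow_lower hhf ht j), hne j⟩)
    intro i j hij
    simpa using hij

end Sl2

namespace ChevalleyNilradical

open RootSystemBase

variable {n : ℕ} {V : Type*} [NormedAddCommGroup V] [InnerProductSpace ℝ V]
  {Φ : RootSystemBase n V} {L : Type*} [LieRing L] [LieAlgebra ℂ L]
  (C : ChevalleyNilradical Φ L)

include C in
lemma finite : Module.Finite ℂ L := by
  have : Finite {β : V // Φ.IsPos β} :=
    Finite.of_injective (fun β => (⟨β.1, β.2.1⟩ : Φ.R)) fun a b h => by
      simpa [Subtype.ext_iff] using h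
  exact Module.Finite.of_basis C.e

open Classical in
/-- The root vector attached to a vector `v`, with the convention that it vanishes if `v` is not
a positive root. -/
noncomputable def E (v : V) : L := if h : Φ.IsPos v then C.e ⟨v, h⟩ else 0

lemma E_of_isPos {v : V} (h : Φ.IsPos v) : C.E v = C.e ⟨v, h⟩ := dif_pos h

lemma E_of_not_isPos {v : V} (h : ¬ Φ.IsPos v) : C.E v = 0 := dif_neg h

lemma E_ne_zero {v : V} (h : Φ.IsPos v) : C.E v ≠ 0 := by
  rw [C.E_of_isPos h]; exact C.e.ne_zero _

lemma isPos_of_smul_E_ne_zero {v : V} {c : ℂ} (h : c • C.E v ≠ 0) : Φ.IsPos v := by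
  by_contra h'
  exact h (by rw [C.E_of_not_isPos h', smul_zero])

lemma lie_E {α β : V} (hα : Φ.IsPos α) (hβ : Φ.IsPos β) :
    ⁅C.E α, C.E β⁆ = C.N α β • C.E (α + β) := by
  rw [C.E_of_isPos hα, C.E_of_isPos hβ]
  by_cases h : Φ.IsPos (α + β)
  · rw [C.E_of_isPos h, C.lie_eq ⟨α, hα⟩ ⟨β, hβ⟩ h]
  · rw [C.E_of_not_isPos h, C.lie_eq_zero ⟨α, hα⟩ ⟨β, hβ⟩ h, smul_zero]

lemma N_ne {α β : V} (hα : Φ.IsPos α) (hβ : Φ.IsPos β) (h : Φ.IsPos (α + β)) : C.N α β ≠ 0 :=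
  C.N_ne_zero ⟨α, hα⟩ ⟨β, hβ⟩ h

lemma not_isPos_add_of_lie_eq_zero {α β : V} (hα : Φ.IsPos α) (hβ : Φ.IsPos β)
    (h : ⁅C.E α, C.E β⁆ = 0) : ¬ Φ.IsPos (α + β) := by
  intro hp
  rw [C.lie_E hα hβ] at h
  exact (smul_ne_zero (C.N_ne hα hβ hp) (C.E_ne_zero hp)) h

variable {C} in
lemma hom_ext {M : Type*} [AddCommGroup M] [Module ℂ M] {S T : L →ₗ[ℂ] M}
    (h : ∀ β, Φ.IsPos β → S (C.E β) = T (C.E β)) : S = T :=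
  C.e.ext fun β => by have := h β.1 β.2; rwa [C.E_of_isPos β.2] at this

/-- The linear map with prescribed values on the root vectors. -/
noncomputable def lift (F : V → L) : Module.End ℂ L := C.e.constr ℂ fun β => F β.1

lemma lift_E (F : V → L) {β : V} (h : Φ.IsPos β) : C.lift F (C.E β) = F β := by
  rw [C.E_of_isPos h, lift, Module.Basis.constr_basis]

open Classical in
/-- The coordinate function along the root vector `E v`. -/
noncomputable def coordE (v : V) : L →ₗ[ℂ] ℂ := if h : Φ.IsPos v then C.e.coord ⟨v, h⟩ else 0

lemma coordE_of_not_isPos {v : V} (h : ¬ Φ.IsPos v) : C.coordE v = 0 := dif_neg h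

lemma coordE_self {v : V} (h : Φ.IsPos v) : C.coordE v (C.E v) = 1 := by
  rw [C.E_of_isPos h, coordE, dif_pos h]; simp

lemma coordE_of_ne {v w : V} (h : w ≠ v) : C.coordE v (C.E w) = 0 := by
  by_cases hw : Φ.IsPos w
  · by_cases hv : Φ.IsPos v
    · rw [C.E_of_isPos hw, coordE, dif_pos hv, Module.Basis.coord_apply,
        Module.Basis.repr_self, Finsupp.single_eq_of_ne]
      simpa [Subtype.ext_iff] using Ne.symm h
    · rw [C.coordE_of_not_isPos hv]; rfl
  · rw [C.E_of_not_isPos hw, map_zero]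

variable {C} in
lemma coordE_ext {x y : L} (h : ∀ v, Φ.IsPos v → C.coordE v x = C.coordE v y) : x = y :=
  C.e.ext_elem fun v => by
    have := h v.1 v.2
    rwa [coordE, dif_pos v.2] at this

lemma coordE_lie_smul (v : V) (x : L) {β : V} (hβ : Φ.IsPos β) :
    C.coordE v ⁅x, C.E β⁆ • C.E v = ⁅C.coordE (v - β) x • C.E (v - β), C.E β⁆ := by
  let b : L →ₗ[ℂ] L →ₗ[ℂ] L := (LieModule.toEnd ℂ L L).toLinearMap
  have : (LinearMap.toSpanSingleton ℂ L (C.E v) ∘ₗ C.coordE v) ∘ₗ b.flip (C.E β) =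
      b.flip (C.E β) ∘ₗ
        (LinearMap.toSpanSingleton ℂ L (C.E (v - β)) ∘ₗ C.coordE (v - β)) := by
    refine C.hom_ext fun γ hγ => ?_
    simp only [b, LinearMap.comp_apply, LinearMap.flip_apply, LieHom.coe_toLinearMap,
      LieModule.toEnd_apply_apply, LinearMap.toSpanSingleton_apply]
    rw [C.lie_E hγ hβ]
    by_cases h : γ + β = v
    · subst h
      rw [add_sub_cancel_right, C.coordE_self hγ, one_smul, C.lie_E hγ hβ]
      by_cases hp : Φ.IsPos (γ + β)
      · rw [map_smul, C.coordE_self hp]; simp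
      · simp [C.E_of_not_isPos hp]
    · rw [map_smul, C.coordE_of_ne h, C.coordE_of_ne (fun h' => h (by rw [h']; simp))]
      simp
  simpa [b] using LinearMap.congr_fun this x

/-- A linear map is homogeneous of weight `ω` if it shifts all weights by `ω`. -/
def IsHomogeneous (ω : V) (T : Module.End ℂ L) : Prop :=
  ∀ β, Φ.IsPos β → ∃ c : ℂ, T (C.E β) = c • C.E (β + ω)

/-- The component of weight `ω` of a linear map. -/
noncomputable def component (ω : V) (T : Module.End ℂ L) : Module.End ℂ L :=
  C.lift fun β => C.coordE (β + ω) (T (C.E β)) • C.E (β + ω)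

lemma component_E (ω : V) (T : Module.End ℂ L) {β : V} (h : Φ.IsPos β) :
    C.component ω T (C.E β) = C.coordE (β + ω) (T (C.E β)) • C.E (β + ω) := C.lift_E _ h

lemma isHomogeneous_component (ω : V) (T : Module.End ℂ L) :
    C.IsHomogeneous ω (C.component ω T) := fun _ hβ => ⟨_, C.component_E ω T hβ⟩

variable {C} in
lemma isLieDerivation_of_E {T : Module.End ℂ L}
    (h : ∀ α β, Φ.IsPos α → Φ.IsPos β →
      T ⁅C.E α, C.E β⁆ = ⁅T (C.E α), C.E β⁆ + ⁅C.E α, T (C.E β)⁆) : IsLieDerivation T := by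
  let b : L →ₗ[ℂ] L →ₗ[ℂ] L := (LieModule.toEnd ℂ L L).toLinearMap
  have : b.compr₂ T = b ∘ₗ T + b.compl₂ T := by
    refine C.hom_ext fun α hα => C.hom_ext fun β hβ => ?_
    simpa [b] using h α β hα hβ
  intro x y
  simpa [b] using LinearMap.congr_fun (LinearMap.congr_fun this x) y

variable {C} in
lemma isLieDerivation_component {T : Module.End ℂ L} (hT : IsLieDerivation T) (ω : V) :
    IsLieDerivation (C.component ω T) := by
  refine C.isLieDerivation_of_E fun α β hα hβ => ?_
  have h1 : C.component ω T ⁅C.E α, C.E β⁆ =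
      C.coordE (α + β + ω) (T ⁅C.E α, C.E β⁆) • C.E (α + β + ω) := by
    rw [C.lie_E hα hβ, map_smul, map_smul, map_smul]
    by_cases hp : Φ.IsPos (α + β)
    · rw [C.component_E _ _ hp, smul_assoc]
    · simp [C.E_of_not_isPos hp]
  rw [h1, hT, map_add, add_smul, C.coordE_lie_smul _ _ hβ, ← lie_skew, ← lie_skew (C.E α), map_neg,
    neg_smul, C.coordE_lie_smul _ _ hα, C.component_E _ _ hα, C.component_E _ _ hβ, lie_skew,
    show α + β + ω - β = α + ω by abel, show α + β + ω - α = β + ω by abel]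
  rw [← lie_skew (C.E α)]

lemma exists_eq_sum_component (T : Module.End ℂ L) :
    ∃ W : Finset V, T = ∑ ω ∈ W, C.component ω T := by
  classical
  refine ⟨(Φ.R ×ˢ Φ.R).image fun p => p.1 - p.2, C.hom_ext fun β hβ => ?_⟩
  refine C.coordE_ext fun γ hγ => ?_
  rw [LinearMap.sum_apply, map_sum, Finset.sum_eq_single (γ - β)]
  · rw [C.component_E _ _ hβ, add_sub_cancel, map_smul, C.coordE_self hγ, smul_eq_mul, mul_one]
  · intro ω _ hω
    rw [C.component_E _ _ hβ, map_smul, C.coordE_of_ne, smul_zero]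
    rintro rfl
    exact hω (by abel)
  · intro h
    exact absurd (Finset.mem_image.2
      ⟨(γ, β), Finset.mem_product.2 ⟨hγ.1, hβ.1⟩, rfl⟩) h

variable {C} in
/-- A derivation which kills the simple root vectors vanishes. -/
lemma eq_zero_of_simple {T : Module.End ℂ L} (hT : IsLieDerivation T)
    (h : ∀ i, T (C.E (Φ.simple i)) = 0) : T = 0 := by
  refine C.hom_ext fun β hβ => ?_
  obtain ⟨k, hk⟩ := exists_nat_gt (∑ i, Φ.coeff i β)
  induction k generalizing β with
  | zero =>
    exact absurd hk (not_lt.2 (by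
      rw [Nat.cast_zero]; exact Finset.sum_nonneg fun i _ => hβ.coeff_nonneg i))
  | succ k ih =>
    by_cases hs : ∃ i, β = Φ.simple i
    · obtain ⟨i, rfl⟩ := hs
      simpa using h i
    · push Not at hs
      obtain ⟨i, hi⟩ := hβ.exists_isPos_sub_simple hs
      have h1 := ih _ hi (by
        simp only [map_sub, Finset.sum_sub_distrib, coeff_simple]
        simp at hk ⊢
        linarith)
      have h2 := hT (C.E (Φ.simple i)) (C.E (β - Φ.simple i))
      rw [h i, h1, C.lie_E (isPos_simple i) hi, add_sub_cancel, map_smul] at h2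
      have h3 : C.N (Φ.simple i) (β - Φ.simple i) ≠ 0 :=
        C.N_ne (isPos_simple i) hi (by rwa [add_sub_cancel])
      simpa [h3] using h2

section Raising

variable (i : Fin n)

/-- The action of the coroot of a simple root on the span of the other root vectors. -/
private noncomputable def cartan : Module.End ℂ L := open Classical in
  C.lift fun β => if β = Φ.simple i then 0 else (pairing (Φ.simple i) β : ℂ) • C.E β

/-- The operator completing `ad (E αᵢ)` and the coroot to a representation of `𝔰𝔩(2)`. -/
private noncomputable def lower : Module.End ℂ L := open Classical in
  C.lift fun β => if β = Φ.simple i then 0 else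
    (((Φ.depth (Φ.simple i) β : ℂ) * (Φ.depth (-Φ.simple i) β + 1)) /
      C.N (Φ.simple i) (β - Φ.simple i)) • C.E (β - Φ.simple i)

/-- The projection killing the root vector of a simple root. -/
private noncomputable def proj : Module.End ℂ L := open Classical in
  C.lift fun β => if β = Φ.simple i then 0 else C.E β

private lemma cartan_self : C.cartan i (C.E (Φ.simple i)) = 0 := by
  rw [cartan, C.lift_E _ (isPos_simple i), if_pos rfl]

private lemma lower_self : C.lower i (C.E (Φ.simple i)) = 0 := by
  rw [lower, C.lift_E _ (isPos_simple i), if_pos rfl]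

private lemma proj_self : C.proj i (C.E (Φ.simple i)) = 0 := by
  rw [proj, C.lift_E _ (isPos_simple i), if_pos rfl]

variable {i}

private lemma cartan_E {β : V} (h : β ≠ Φ.simple i) :
    C.cartan i (C.E β) = (pairing (Φ.simple i) β : ℂ) • C.E β := by
  by_cases hβ : Φ.IsPos β
  · rw [cartan, C.lift_E _ hβ, if_neg h]
  · simp [C.E_of_not_isPos hβ]

private lemma proj_E {β : V} (h : β ≠ Φ.simple i) : C.proj i (C.E β) = C.E β := by
  by_cases hβ : Φ.IsPos β
  · rw [proj, C.lift_E _ hβ, if_neg h]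
  · simp [C.E_of_not_isPos hβ]

private lemma lower_E {β : V} (hβ : Φ.IsPos β) (h : β ≠ Φ.simple i) :
    C.lower i (C.E β) =
      (((Φ.depth (Φ.simple i) β : ℂ) * (Φ.depth (-Φ.simple i) β + 1)) /
      C.N (Φ.simple i) (β - Φ.simple i)) • C.E (β - Φ.simple i) := by
  rw [lower, C.lift_E _ hβ, if_neg h]

private lemma isPos_sub {β : V} (hβ : Φ.IsPos β) (h : β ≠ Φ.simple i)
    (hm : β - Φ.simple i ∈ Φ.R) : Φ.IsPos (β - Φ.simple i) := by
  have he : β - Φ.simple i = β + (-1 : ℝ) • Φ.simple i := by module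
  exact he ▸ (hβ.add_smul h (he ▸ hm)).1

private lemma ad_lower_E {β : V} (hβ : Φ.IsPos β) (h : β ≠ Φ.simple i) :
    ⁅C.E (Φ.simple i), C.lower i (C.E β)⁆ =
      ((Φ.depth (Φ.simple i) β : ℂ) * (Φ.depth (-Φ.simple i) β + 1)) • C.E β := by
  rw [C.lower_E hβ h]
  by_cases hm : β - Φ.simple i ∈ Φ.R
  · have hp := isPos_sub hβ h hm
    rw [lie_smul, C.lie_E (isPos_simple i) hp, add_sub_cancel, smul_smul, div_mul_cancel₀]
    exact C.N_ne (isPos_simple i) hp (by rwa [add_sub_cancel])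
  · rw [C.E_of_not_isPos (fun h' => hm h'.1), smul_zero, lie_zero,
      depth_eq_zero (Φ.simple_mem i) hβ.1 (hβ.ne_smul h) hm]
    simp

private lemma lower_ad_E {β : V} (hβ : Φ.IsPos β) (h : β ≠ Φ.simple i) :
    C.lower i ⁅C.E (Φ.simple i), C.E β⁆ =
      (((Φ.depth (Φ.simple i) β : ℂ) + 1) * Φ.depth (-Φ.simple i) β) • C.E β := by
  rw [C.lie_E (isPos_simple i) hβ, map_smul]
  by_cases hm : β + Φ.simple i ∈ Φ.R
  · have hm1 : β + (1 : ℝ) • Φ.simple i ∈ Φ.R := by rwa [one_smul]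
    obtain ⟨hp, hne⟩ := hβ.add_smul h hm1
    rw [one_smul] at hp hne
    have hN : C.N (Φ.simple i) β ≠ 0 := C.N_ne (isPos_simple i) hβ (by rwa [add_comm])
    have hd := depth_add (neg_mem (Φ.simple_mem i)) hm (by simpa using hβ.1)
    rw [add_neg_cancel_right] at hd
    rw [add_comm, C.lower_E hp hne, add_sub_cancel_right, smul_smul, mul_div_cancel₀ _ hN,
      depth_add (Φ.simple_mem i) hβ.1 hm, hd]
    push_cast
    rfl
  · rw [add_comm, C.E_of_not_isPos (fun h' => hm h'.1), map_zero, smul_zero,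
      depth_eq_zero (neg_mem (Φ.simple_mem i)) hβ.1 _ (by simpa using hm)]
    · simp
    · intro c hc
      exact hβ.ne_smul h (-c) (by rw [hc]; simp)

private lemma ne_add {β : V} (hβ : Φ.IsPos β) : Φ.simple i + β ≠ Φ.simple i :=
  fun h => ne_zero_of_mem hβ.1 (by simpa using h)

variable (i)

private lemma lie_ad_lower : ⁅LieAlgebra.ad ℂ L (C.E (Φ.simple i)), C.lower i⁆ = C.cartan i := by
  refine C.hom_ext fun β hβ => ?_
  rw [LieRing.of_associative_ring_bracket, LinearMap.sub_apply, Module.End.mul_apply,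
    Module.End.mul_apply, LieAlgebra.ad_apply, LieAlgebra.ad_apply]
  by_cases h : β = Φ.simple i
  · subst h; simp [C.lower_self, C.cartan_self]
  · rw [C.ad_lower_E hβ h, C.lower_ad_E hβ h, C.cartan_E h, ← sub_smul,
      ← depth_sub_depth (Φ.simple_mem i) hβ.1]
    congr 1
    push_cast
    ring

private lemma lie_cartan_ad : ⁅C.cartan i, LieAlgebra.ad ℂ L (C.E (Φ.simple i))⁆ =
    (2 : ℂ) • LieAlgebra.ad ℂ L (C.E (Φ.simple i)) := by
  refine C.hom_ext fun β hβ => ?_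
  rw [LieRing.of_associative_ring_bracket, LinearMap.sub_apply, Module.End.mul_apply,
    Module.End.mul_apply, LinearMap.smul_apply, LieAlgebra.ad_apply, LieAlgebra.ad_apply]
  by_cases h : β = Φ.simple i
  · subst h; simp [C.cartan_self]
  · rw [C.cartan_E h, C.lie_E (isPos_simple i) hβ, map_smul, C.cartan_E (ne_add hβ), lie_smul,
      C.lie_E (isPos_simple i) hβ, pairing_add, pairing_self (Φ.simple_mem i)]
    push_cast
    module

private lemma lie_cartan_lower : ⁅C.cartan i, C.lower i⁆ = -((2 : ℂ) • C.lower i) := by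
  refine C.hom_ext fun β hβ => ?_
  rw [LieRing.of_associative_ring_bracket, LinearMap.sub_apply, Module.End.mul_apply,
    Module.End.mul_apply, LinearMap.neg_apply, LinearMap.smul_apply]
  by_cases h : β = Φ.simple i
  · subst h; simp [C.cartan_self, C.lower_self]
  · have h2 : β - Φ.simple i ≠ Φ.simple i := fun h' =>
      hβ.ne_smul h 2 (by rw [sub_eq_iff_eq_add.1 h']; module)
    rw [C.cartan_E h, map_smul, C.lower_E hβ h, map_smul, C.cartan_E h2, pairing_sub,
      pairing_self (Φ.simple_mem i)]
    push_cast
    module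

variable {i}

variable {C} in
private lemma lie_cartan_of_isHomogeneous {S : Module.End ℂ L} {ω : V}
    (hS : C.IsHomogeneous ω S)
    (h0 : S (C.E (Φ.simple i)) = 0)
    (hω : ∀ ν, Φ.IsPos ν → ν ≠ Φ.simple i → ν + ω ≠ Φ.simple i) :
    ⁅C.cartan i, S⁆ = (pairing (Φ.simple i) ω : ℂ) • S := by
  refine C.hom_ext fun β hβ => ?_
  rw [LieRing.of_associative_ring_bracket, LinearMap.sub_apply, Module.End.mul_apply,
    Module.End.mul_apply, LinearMap.smul_apply]
  by_cases h : β = Φ.simple i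
  · subst h; simp [C.cartan_self, h0]
  · obtain ⟨c, hc⟩ := hS β hβ
    rw [C.cartan_E h, map_smul, hc, map_smul, C.cartan_E (hω β hβ h), pairing_add]
    push_cast
    module

/-- A homogeneous linear map killing `E αᵢ`, of weight at most `-k` with respect to the coroot
of `αᵢ`, vanishes if it is killed by the `k`-th power of `ad (ad (E αᵢ))`. -/
private lemma eq_zero_of_isHomogeneous {S : Module.End ℂ L} {ω : V} (hωR : ∃ a : ℤ,
      pairing (Φ.simple i) ω = a) (hS : C.IsHomogeneous ω S)
    (h0 : S (C.E (Φ.simple i)) = 0)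
    (hω : ∀ ν, Φ.IsPos ν → ν ≠ Φ.simple i → ν + ω ≠ Φ.simple i)
    {k : ℕ} (hk : pairing (Φ.simple i) ω ≤ -k)
    (hkS : (LieAlgebra.ad ℂ (Module.End ℂ L) (LieAlgebra.ad ℂ L (C.E (Φ.simple i))) ^ k) S = 0) :
    S = 0 := by
  have := C.finite
  obtain ⟨a, ha⟩ := hωR
  have hw := lie_cartan_of_isHomogeneous hS h0 hω
  rw [ha] at hw hk
  refine eq_zero_of_pow_raise_eq_zero
    (e := LieAlgebra.ad ℂ (Module.End ℂ L) (LieAlgebra.ad ℂ L (C.E (Φ.simple i))))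
    (f := LieAlgebra.ad ℂ (Module.End ℂ L) (C.lower i))
    (h := LieAlgebra.ad ℂ (Module.End ℂ L) (C.cartan i)) ?_ ?_ ?_ k a (by exact_mod_cast hk) S
    (by simpa using hw) hkS
  · intro m
    simp only [LieAlgebra.ad_apply]
    rw [leibniz_lie, C.lie_ad_lower, add_comm]
  · intro m
    simp only [LieAlgebra.ad_apply]
    rw [leibniz_lie, C.lie_cartan_ad, smul_lie, add_comm]
  · intro m
    simp only [LieAlgebra.ad_apply]
    rw [leibniz_lie, C.lie_cartan_lower, neg_lie, smul_lie, add_comm, sub_eq_add_neg]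

private lemma lie_ad_mul_proj (S : Module.End ℂ L) :
    ⁅LieAlgebra.ad ℂ L (C.E (Φ.simple i)), S * C.proj i⁆ =
      ⁅LieAlgebra.ad ℂ L (C.E (Φ.simple i)), S⁆ * C.proj i := by
  have h : C.proj i * LieAlgebra.ad ℂ L (C.E (Φ.simple i)) =
      LieAlgebra.ad ℂ L (C.E (Φ.simple i)) * C.proj i := by
    refine C.hom_ext fun β hβ => ?_
    rw [Module.End.mul_apply, Module.End.mul_apply, LieAlgebra.ad_apply, LieAlgebra.ad_apply]
    by_cases hb : β = Φ.simple i
    · subst hb; simp [C.proj_self]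
    · rw [C.proj_E hb, C.lie_E (isPos_simple i) hβ, map_smul, C.proj_E (ne_add hβ)]
  rw [LieRing.of_associative_ring_bracket, LieRing.of_associative_ring_bracket, sub_mul,
    mul_assoc, mul_assoc, mul_assoc, h]

omit C in
private lemma lie_ad_of_isLieDerivation {T : Module.End ℂ L} (hT : IsLieDerivation T) (x : L) :
    ⁅LieAlgebra.ad ℂ L x, T⁆ = -LieAlgebra.ad ℂ L (T x) := by
  ext y
  simp only [LieRing.of_associative_ring_bracket, LinearMap.sub_apply, Module.End.mul_apply,
    LieAlgebra.ad_apply, LinearMap.neg_apply, hT x y]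
  abel

private lemma isHomogeneous_mul_proj {T : Module.End ℂ L} {ω : V} (hT : C.IsHomogeneous ω T) :
    C.IsHomogeneous ω (T * C.proj i) := by
  intro β hβ
  rw [Module.End.mul_apply]
  by_cases hb : β = Φ.simple i
  · exact ⟨0, by subst hb; simp [C.proj_self]⟩
  · rw [C.proj_E hb]; exact hT β hβ

private lemma pow_ad_ad_mul_proj (x : L) (k : ℕ) :
    (LieAlgebra.ad ℂ (Module.End ℂ L) (LieAlgebra.ad ℂ L (C.E (Φ.simple i))) ^ k)
      (LieAlgebra.ad ℂ L x * C.proj i) =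
      LieAlgebra.ad ℂ L ((LieAlgebra.ad ℂ L (C.E (Φ.simple i)) ^ k) x) * C.proj i := by
  induction k with
  | zero => simp
  | succ k ih =>
    rw [pow_succ', Module.End.mul_apply, ih, LieAlgebra.ad_apply, lie_ad_mul_proj, pow_succ',
      Module.End.mul_apply, LieAlgebra.ad_apply, LieHom.map_lie]

private lemma exists_pow_ad_E (β : V) (k : ℕ) :
    ∃ c : ℂ, (LieAlgebra.ad ℂ L (C.E (Φ.simple i)) ^ k) (C.E β) =
      c • C.E (β + (k : ℝ) • Φ.simple i) := by
  induction k with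
  | zero => exact ⟨1, by simp⟩
  | succ k ih =>
    obtain ⟨c, hc⟩ := ih
    rw [pow_succ', Module.End.mul_apply, hc, map_smul, LieAlgebra.ad_apply]
    by_cases hp : Φ.IsPos (β + (k : ℝ) • Φ.simple i)
    · refine ⟨c * C.N (Φ.simple i) (β + (k : ℝ) • Φ.simple i), ?_⟩
      rw [C.lie_E (isPos_simple i) hp, smul_smul]
      congr 2
      push_cast
      module
    · exact ⟨0, by simp [C.E_of_not_isPos hp]⟩

variable {C} in
private lemma apply_eq_zero_of_mul_proj_eq_zero {T : Module.End ℂ L} (h : T * C.proj i = 0) {β : V}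
    (hb : β ≠ Φ.simple i) : T (C.E β) = 0 := by
  rw [← C.proj_E hb, ← Module.End.mul_apply, h, LinearMap.zero_apply]

variable {C} in
/-- If a homogeneous derivation `T` of weight `ω` kills `E αᵢ` and `ω` pairs negatively with
`αᵢ`, then `T = 0`. -/
lemma eq_zero_of_pairing_neg {T : Module.End ℂ L} {ω : V} (hT : IsLieDerivation T)
    (hω : Φ.IsPos ω) (hTω : C.IsHomogeneous ω T) (h0 : T (C.E (Φ.simple i)) = 0)
    (hneg : pairing (Φ.simple i) ω < 0) : T = 0 := by
  obtain ⟨a, ha⟩ := exists_int_pairing (Φ.simple_mem i) hω.1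
  have hS : T * C.proj i = 0 := by
    refine C.eq_zero_of_isHomogeneous (k := 1) ⟨a, ha⟩ (C.isHomogeneous_mul_proj hTω) ?_ ?_ ?_ ?_
    · rw [Module.End.mul_apply, C.proj_self, map_zero]
    · exact fun ν hν _ => hν.add_ne_simple hω i
    · rw [ha] at hneg ⊢
      have : a < 0 := by exact_mod_cast hneg
      exact_mod_cast (by omega : a ≤ -1)
    · rw [pow_one, LieAlgebra.ad_apply, lie_ad_mul_proj, lie_ad_of_isLieDerivation hT, h0]
      simp
  refine C.hom_ext fun β hβ => ?_
  by_cases hb : β = Φ.simple i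
  · rw [hb, h0]; rfl
  · rw [apply_eq_zero_of_mul_proj_eq_zero hS hb]; rfl

variable {C} in
/-- If a homogeneous derivation `T` of weight `β - αᵢ`, not a root, does not kill `E αᵢ`, then
it kills all other root vectors. -/
lemma apply_eq_zero_of_sub_not_mem {T : Module.End ℂ L} {β : V} (hT : IsLieDerivation T)
    (hβ : Φ.IsPos β) (hne : β ≠ Φ.simple i) (hnot : β - Φ.simple i ∉ Φ.R)
    (hTω : C.IsHomogeneous (β - Φ.simple i) T) {ν : V} (hν : ν ≠ Φ.simple i) :
    T (C.E ν) = 0 := by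
  obtain ⟨a, ha⟩ := exists_int_pairing (Φ.simple_mem i) hβ.1
  have hd := depth_sub_depth (Φ.simple_mem i) hβ.1
  rw [depth_eq_zero (Φ.simple_mem i) hβ.1 (hβ.ne_smul hne) hnot] at hd
  set q := Φ.depth (-Φ.simple i) β with hq
  have hpair : pairing (Φ.simple i) (β - Φ.simple i) = -((q + 2 : ℕ) : ℝ) := by
    rw [pairing_sub, pairing_self (Φ.simple_mem i), ← hd]; push_cast; ring
  refine apply_eq_zero_of_mul_proj_eq_zero (i := i)
    (C.eq_zero_of_isHomogeneous (k := q + 2) ⟨-((q + 2 : ℕ) : ℤ), by rw [hpair]; push_cast; ring⟩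
      (C.isHomogeneous_mul_proj hTω) ?_ ?_ hpair.le ?_) hν
  · rw [Module.End.mul_apply, C.proj_self, map_zero]
  · intro ν hν hνi h
    obtain ⟨j, hj, hpos⟩ := hν.exists_coeff_pos_of_ne hνi
    have := congrArg (Φ.coeff j) h
    rw [map_add, map_sub, coeff_simple_of_ne hj] at this
    linarith [hβ.coeff_nonneg j]
  · obtain ⟨c, hc⟩ := hTω _ (isPos_simple i)
    obtain ⟨d, hd⟩ := C.exists_pow_ad_E (i := i) β (q + 1)
    have hz : ¬ Φ.IsPos (β + ((q + 1 : ℕ) : ℝ) • Φ.simple i) := by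
      intro h
      have := le_depth (β := β) (neg_mem (Φ.simple_mem i)) (k := q + 1)
        (by rw [smul_neg, sub_neg_eq_add]; exact h.1)
      omega
    rw [C.E_of_not_isPos hz, smul_zero] at hd
    rw [pow_succ, Module.End.mul_apply, LieAlgebra.ad_apply, lie_ad_mul_proj,
      lie_ad_of_isLieDerivation hT, neg_mul, map_neg, pow_ad_ad_mul_proj, hc, add_sub_cancel,
      map_smul, hd]
    simp

end Raising

include C in
lemma not_isPos_add_simple_add {i : Fin n} {β : V} (hβ : Φ.IsPos β)
    (h : ∀ ν, Φ.IsPos ν → ν ≠ Φ.simple i → ¬ Φ.IsPos (β + ν))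
    (hp : Φ.IsPos (β + Φ.simple i)) {ν : V} (hν : Φ.IsPos ν) (hne : ν ≠ Φ.simple i) :
    ¬ Φ.IsPos (β + Φ.simple i + ν) := by
  have key : ∀ ξ, ξ ≠ Φ.simple i → ⁅C.E β, C.E ξ⁆ = 0 := by
    intro ξ hξ
    by_cases hξp : Φ.IsPos ξ
    · rw [C.lie_E hβ hξp, C.E_of_not_isPos (h ξ hξp hξ), smul_zero]
    · rw [C.E_of_not_isPos hξp, lie_zero]
  have hj := leibniz_lie (C.E (Φ.simple i)) (C.E β) (C.E ν)
  rw [key ν hne, lie_zero, C.lie_E (isPos_simple i) hβ, C.lie_E (isPos_simple i) hν, lie_smul,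
    key _ (ne_add hν), smul_zero, add_zero, smul_lie, add_comm (Φ.simple i)] at hj
  refine C.not_isPos_add_of_lie_eq_zero hp hν ?_
  exact (smul_eq_zero.1 hj.symm).resolve_left
    (C.N_ne (isPos_simple i) hβ (by rwa [add_comm]))

include C in
/-- If `β` is the lowest root of its `αᵢ`-string and the root vectors of `β` and of every positive
root other than `αᵢ` commute, then the `αᵢ`-string of `β` ends at the highest root. -/
lemma exists_eq_highest_sub {μ : V} (hμ : Φ.IsHighest μ) {i : Fin n} {β : V} (hβ : Φ.IsPos β)
    (h : ∀ ν, Φ.IsPos ν → ν ≠ Φ.simple i → ¬ Φ.IsPos (β + ν)) :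
    ∃ k : ℕ, β = μ - k • Φ.simple i := by
  by_contra! hk
  have key : ∀ k : ℕ, Φ.IsPos (β + k • Φ.simple i) ∧
      ∀ ν, Φ.IsPos ν → ν ≠ Φ.simple i → ¬ Φ.IsPos (β + k • Φ.simple i + ν) := by
    intro k
    induction k with
    | zero => simpa using ⟨hβ, h⟩
    | succ k ih =>
      rw [succ_nsmul, ← add_assoc]
      have hp : Φ.IsPos (β + k • Φ.simple i + Φ.simple i) := by
        by_contra hp
        refine hk k (eq_sub_of_add_eq (hμ.eq_of_add_not_isPos ih.1 fun ν hν => ?_))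
        by_cases hνi : ν = Φ.simple i
        · rwa [hνi]
        · exact ih.2 ν hν hνi
      exact ⟨hp, fun ν hν hne => C.not_isPos_add_simple_add ih.1 ih.2 hp hν hne⟩
  have := le_depth (β := β) (neg_mem (Φ.simple_mem i)) (k := Φ.depth (-Φ.simple i) β + 1)
    (by rw [smul_neg, sub_neg_eq_add, Nat.cast_smul_eq_nsmul]; exact (key _).1.1)
  omega

section B

variable {μ : V} {m : Fin n → ℕ} (hγ : ∀ i, Φ.IsPos (μ - m i • Φ.simple i))

lemma B_self (i : Fin n) :
    C.B μ m hγ i (C.E (Φ.simple i)) = C.E (μ - m i • Φ.simple i) := by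
  rw [C.E_of_isPos (isPos_simple i), B, Module.Basis.constr_basis, if_pos rfl,
    C.E_of_isPos (hγ i)]

lemma B_of_ne {i : Fin n} {β : V} (h : β ≠ Φ.simple i) : C.B μ m hγ i (C.E β) = 0 := by
  by_cases hβ : Φ.IsPos β
  · rw [C.E_of_isPos hβ, B, Module.Basis.constr_basis, if_neg h]
  · rw [C.E_of_not_isPos hβ, map_zero]

lemma D_E (i : Fin n) {β : V} (h : Φ.IsPos β) :
    C.D i (C.E β) = (Φ.coord β i : ℂ) • C.E β := by
  rw [C.E_of_isPos h, D, Module.Basis.constr_basis]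

lemma isHomogeneous_B (i : Fin n) :
    C.IsHomogeneous (μ - m i • Φ.simple i - Φ.simple i) (C.B μ m hγ i) := by
  intro β hβ
  by_cases h : β = Φ.simple i
  · subst h
    exact ⟨1, by rw [C.B_self, one_smul, add_sub_cancel]⟩
  · exact ⟨0, by rw [C.B_of_ne hγ h, zero_smul]⟩

include hγ in
/-- A nonzero homogeneous derivation whose weight is neither zero nor a root is proportional to
one of the `Bᵢ`. -/
lemma eq_smul_B (hμ : Φ.IsHighest μ)
    (hm : ∀ i, (∀ k : ℕ, k ≤ m i → Φ.IsPos (μ - k • Φ.simple i)) ∧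
      ¬ Φ.IsPos (μ - (m i + 1) • Φ.simple i))
    {T : Module.End ℂ L} (hT : IsLieDerivation T) {ω : V} (hTω : C.IsHomogeneous ω T)
    (hω0 : ω ≠ 0) (hωR : ω ∉ Φ.R) {i : Fin n} (hi : T (C.E (Φ.simple i)) ≠ 0) :
    ∃ c : ℂ, T = c • C.B μ m hγ i := by
  obtain ⟨c, hc⟩ := hTω _ (isPos_simple i)
  obtain ⟨β, rfl⟩ : ∃ β, ω = β - Φ.simple i := ⟨ω + Φ.simple i, by simp⟩
  rw [add_sub_cancel] at hc
  have hc0 : c ≠ 0 := by rintro rfl; exact hi (by rw [hc, zero_smul])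
  have hβ : Φ.IsPos β := C.isPos_of_smul_E_ne_zero (hc ▸ hi)
  have hne : β ≠ Φ.simple i := fun h => hω0 (by rw [h, sub_self])
  have hkill : ∀ ν, ν ≠ Φ.simple i → T (C.E ν) = 0 := fun ν hν =>
    C.apply_eq_zero_of_sub_not_mem hT hβ hne hωR hTω hν
  have hcomm : ∀ ν, Φ.IsPos ν → ν ≠ Φ.simple i → ¬ Φ.IsPos (β + ν) := by
    intro ν hν hνi
    refine C.not_isPos_add_of_lie_eq_zero hβ hν ?_
    have := hT (C.E (Φ.simple i)) (C.E ν)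
    rw [C.lie_E (isPos_simple i) hν, map_smul, hkill _ (ne_add hν), hkill ν hνi, hc, smul_zero,
      lie_zero, add_zero, smul_lie] at this
    exact (smul_eq_zero.1 this.symm).resolve_left hc0
  obtain ⟨k, hk⟩ := C.exists_eq_highest_sub hμ hβ hcomm
  have hkm : k = m i := by
    rcases lt_trichotomy k (m i) with h | h | h
    · refine absurd ((hm i).1 (k + 1) h).1 ?_
      rwa [succ_nsmul, ← sub_sub, ← hk]
    · exact h
    · obtain ⟨l, rfl⟩ := Nat.exists_eq_add_of_lt h
      have hδ : μ - m i • Φ.simple i = β + ((l : ℝ) + 1) • Φ.simple i := by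
        rw [hk, ← Nat.cast_smul_eq_nsmul ℝ, ← Nat.cast_smul_eq_nsmul ℝ]
        push_cast
        module
      have h1 := sub_mem_of_sub_smul_mem (k := l) (Φ.simple_mem i) (hγ i).1
        (fun e he => hβ.ne_smul hne (e - (l + 1)) (by
          rw [hδ] at he
          rw [sub_smul, ← he, add_sub_cancel_right]))
        (by rw [hδ, add_sub_cancel_right]; exact hβ.1)
      have h2 : μ - m i • Φ.simple i - Φ.simple i = β + (l : ℝ) • Φ.simple i := by
        rw [hδ]; module
      rw [h2] at h1
      refine absurd (hβ.add_smul hne h1).1 ?_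
      rw [← h2, sub_sub, ← succ_nsmul]
      exact (hm i).2
  refine ⟨c, C.hom_ext fun ν hν => ?_⟩
  by_cases hνi : ν = Φ.simple i
  · rw [hνi, hc, LinearMap.smul_apply, C.B_self, hk, hkm]
  · rw [hkill ν hνi, LinearMap.smul_apply, C.B_of_ne hγ hνi, smul_zero]

variable {C} in
/-- A homogeneous derivation whose weight is a root is inner. -/
lemma mem_innerDerivations_of_mem {T : Module.End ℂ L} (hT : IsLieDerivation T) {ω : V}
    (hTω : C.IsHomogeneous ω T) (hω : ω ∈ Φ.R) : T ∈ innerDerivations L := by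
  have hzero : (∀ i, T (C.E (Φ.simple i)) = 0) → T ∈ innerDerivations L := fun h => by
    rw [C.eq_zero_of_simple hT h]; exact zero_mem _
  by_cases hex : ∃ i, T (C.E (Φ.simple i)) ≠ 0
  swap
  · push Not at hex
    exact hzero hex
  have hposT : ∀ i, T (C.E (Φ.simple i)) ≠ 0 → Φ.IsPos (Φ.simple i + ω) := fun i hi => by
    obtain ⟨c, hc⟩ := hTω _ (isPos_simple i)
    exact C.isPos_of_smul_E_ne_zero (hc ▸ hi)
  have hωp : Φ.IsPos ω := by
    obtain ⟨i, hi⟩ := hex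
    refine ⟨hω, (Φ.coord_sign ω hω).resolve_right fun hneg => ?_⟩
    have hn : Φ.IsPos (-ω) := isPos_of_coeff_nonneg (neg_mem hω) fun j => by
      rw [map_neg, coeff_root hω]
      have := hneg j
      rw [Left.nonneg_neg_iff]
      exact_mod_cast this
    exact (hposT i hi).add_ne_simple hn i (by simp)
  have hder : ∀ i, Φ.IsPos (Φ.simple i + ω) → ∃ S : Module.End ℂ L, IsLieDerivation S ∧
      C.IsHomogeneous ω S ∧ S (C.E (Φ.simple i)) = 0 ∧
      (∀ j, ¬ Φ.IsPos (Φ.simple j + ω) → S (C.E (Φ.simple j)) = 0) ∧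
      (S = 0 → T ∈ innerDerivations L) := by
    intro i hi
    obtain ⟨c, hc⟩ := hTω _ (isPos_simple i)
    have hN : C.N ω (Φ.simple i) ≠ 0 := C.N_ne hωp (isPos_simple i) (by rwa [add_comm])
    have had : ∀ β, Φ.IsPos β →
        LieAlgebra.ad ℂ L (C.E ω) (C.E β) = C.N ω β • C.E (β + ω) := fun β hβ => by
      rw [LieAlgebra.ad_apply, C.lie_E hωp hβ, add_comm]
    refine ⟨T - (c / C.N ω (Φ.simple i)) • LieAlgebra.ad ℂ L (C.E ω), ?_, ?_, ?_, ?_, ?_⟩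
    · refine (derivations L).sub_mem hT ((derivations L).smul_mem _ fun x y => ?_)
      simp only [LieAlgebra.ad_apply]
      exact leibniz_lie _ _ _
    · intro β hβ
      obtain ⟨d, hd⟩ := hTω β hβ
      exact ⟨d - c / C.N ω (Φ.simple i) * C.N ω β, by
        rw [LinearMap.sub_apply, LinearMap.smul_apply, had β hβ, hd]; module⟩
    · rw [LinearMap.sub_apply, LinearMap.smul_apply, had _ (isPos_simple i), hc, smul_smul,
        div_mul_cancel₀ _ hN, sub_self]
    · intro j hj
      obtain ⟨d, hd⟩ := hTω _ (isPos_simple j)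
      rw [LinearMap.sub_apply, LinearMap.smul_apply, had _ (isPos_simple j), hd,
        C.E_of_not_isPos hj]
      simp
    · intro h
      rw [sub_eq_zero.1 h]
      exact Submodule.smul_mem _ _ ⟨C.E ω, rfl⟩
  by_cases hdom : ∀ i, 0 ≤ ⟪ω, Φ.simple i⟫_ℝ
  · obtain ⟨i, hi⟩ := hex
    obtain ⟨S, hS, -, hSi, hSj, himp⟩ := hder i (hposT i hi)
    refine himp (C.eq_zero_of_simple hS fun j => ?_)
    by_cases hj : Φ.IsPos (Φ.simple j + ω)
    · have := eq_of_add_simple_mem hω hdom (i := i) (j := j)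
        (by rw [add_comm]; exact (hposT i hi).1) (by rw [add_comm]; exact hj.1)
      rwa [← this]
    · exact hSj j hj
  · push Not at hdom
    obtain ⟨i, hi⟩ := hdom
    have hm := add_mem hω (Φ.simple_mem i) hi fun h0 =>
      not_isPos_neg hωp (by rw [← eq_neg_iff_add_eq_zero.2 (by rwa [add_comm])]
                            exact isPos_simple i)
    rw [add_comm] at hm
    obtain ⟨S, hS, hSω, hSi, -, himp⟩ := hder i ((isPos_simple i).add hωp hm)
    exact himp (C.eq_zero_of_pairing_neg hS hωp hSω hSi
      ((pairing_neg_iff (Φ.simple_mem i)).2 hi))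

omit C in
lemma isLieDerivation_ad (x : L) : IsLieDerivation (LieAlgebra.ad ℂ L x) := fun y z => by
  simp only [LieAlgebra.ad_apply]
  exact leibniz_lie _ _ _

lemma isLieDerivation_D (i : Fin n) : IsLieDerivation (C.D i) := by
  refine C.isLieDerivation_of_E fun α β hα hβ => ?_
  rw [C.D_E i hα, C.D_E i hβ, smul_lie, lie_smul, C.lie_E hα hβ, map_smul]
  by_cases hp : Φ.IsPos (α + β)
  · have h : Φ.coord (α + β) i = Φ.coord α i + Φ.coord β i := by
      have := map_add (Φ.coeff i) α β
      rw [coeff_root hp.1, coeff_root hα.1, coeff_root hβ.1] at this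
      exact_mod_cast this
    rw [C.D_E i hp, h]
    push_cast
    module
  · simp [C.E_of_not_isPos hp]

lemma coeff_highest_sub {i j : Fin n} (h : j ≠ i) (k : ℕ) :
    Φ.coeff j (μ - k • Φ.simple i) = Φ.coeff j μ := by
  rw [map_sub, map_nsmul, coeff_simple_of_ne h, smul_zero, sub_zero]

lemma isLieDerivation_B (hμ : Φ.IsHighest μ) (i : Fin n) : IsLieDerivation (C.B μ m hγ i) := by
  have key : ∀ β, Φ.IsPos β → β ≠ Φ.simple i →
      ⁅C.E (μ - m i • Φ.simple i), C.E β⁆ = 0 := by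
    intro β hβ hne
    rw [C.lie_E (hγ i) hβ, C.E_of_not_isPos, smul_zero]
    intro hp
    obtain ⟨j, hj, hpos⟩ := hβ.exists_coeff_pos_of_ne hne
    have := hμ.coeff_le hp j
    rw [map_add, coeff_highest_sub hj] at this
    linarith
  refine C.isLieDerivation_of_E fun α β hα hβ => ?_
  rw [C.lie_E hα hβ, map_smul, C.B_of_ne hγ (hα.add_ne_simple hβ i), smul_zero]
  by_cases h1 : α = Φ.simple i
  · by_cases h2 : β = Φ.simple i
    · rw [h1, h2, C.B_self, ← lie_skew, neg_add_cancel]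
    · rw [h1, C.B_self, C.B_of_ne hγ h2, key β hβ h2, lie_zero, add_zero]
  · by_cases h2 : β = Φ.simple i
    · rw [h2, C.B_self, C.B_of_ne hγ h1, zero_lie, ← lie_skew, key α hα h1, neg_zero, add_zero]
    · rw [C.B_of_ne hγ h1, C.B_of_ne hγ h2, zero_lie, lie_zero, add_zero]

lemma D_simple (i j : Fin n) :
    C.D i (C.E (Φ.simple j)) = if j = i then C.E (Φ.simple j) else 0 := by
  have h : Φ.coord (Φ.simple j) i = if j = i then 1 else 0 := by
    have := coeff_root (Φ.simple_mem j) i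
    rw [coeff_simple] at this
    split_ifs at this ⊢ <;> exact_mod_cast this.symm
  rw [C.D_E i (isPos_simple j), h]
  split_ifs <;> simp

variable {C} in
/-- A derivation preserving all weights is a combination of the `Dᵢ`. -/
lemma mem_span_D {T : Module.End ℂ L} (hT : IsLieDerivation T) (hT0 : C.IsHomogeneous 0 T) :
    T ∈ Submodule.span ℂ (Set.range C.D) := by
  choose c hc using fun i => hT0 _ (isPos_simple i)
  have h : T - ∑ i, c i • C.D i = 0 := by
    refine C.eq_zero_of_simple ((derivations L).sub_mem hT ((derivations L).sum_mem fun i _ =>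
      (derivations L).smul_mem _ (C.isLieDerivation_D i))) fun j => ?_
    simp [LinearMap.sum_apply, D_simple, hc]
  rw [sub_eq_zero.1 h]
  exact Submodule.sum_mem _ fun i _ => Submodule.smul_mem _ _ (Submodule.subset_span ⟨i, rfl⟩)

variable {C} in
include hγ in
lemma mem_sup_span {T : Module.End ℂ L} (hμ : Φ.IsHighest μ)
    (hm : ∀ i, (∀ k : ℕ, k ≤ m i → Φ.IsPos (μ - k • Φ.simple i)) ∧
      ¬ Φ.IsPos (μ - (m i + 1) • Φ.simple i)) (hT : IsLieDerivation T) :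
    T ∈ innerDerivations L ⊔ Submodule.span ℂ (Set.range (C.B μ m hγ)) ⊔
      Submodule.span ℂ (Set.range C.D) := by
  obtain ⟨W, hW⟩ := C.exists_eq_sum_component T
  rw [hW]
  refine Submodule.sum_mem _ fun ω _ => ?_
  have h1 := C.isLieDerivation_component hT ω
  have h2 := C.isHomogeneous_component ω T
  by_cases h0 : ω = 0
  · subst h0
    exact Submodule.mem_sup_right (mem_span_D h1 h2)
  refine Submodule.mem_sup_left ?_
  by_cases hωR : ω ∈ Φ.R
  · exact Submodule.mem_sup_left (mem_innerDerivations_of_mem h1 h2 hωR)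
  by_cases hex : ∃ i, C.component ω T (C.E (Φ.simple i)) ≠ 0
  · obtain ⟨i, hi⟩ := hex
    obtain ⟨c, hc⟩ := C.eq_smul_B hγ hμ hm h1 h2 h0 hωR hi
    rw [hc]
    exact Submodule.mem_sup_right (Submodule.smul_mem _ _ (Submodule.subset_span ⟨i, rfl⟩))
  · push Not at hex
    rw [C.eq_zero_of_simple h1 hex]
    exact zero_mem _

omit C in
lemma highest_sub_ne_simple (hμ : Φ.IsHighest μ) (hn : n ≠ 1) (i : Fin n) (k : ℕ) :
    μ - k • Φ.simple i ≠ Φ.simple i := by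
  intro h
  have : Nontrivial (Fin n) := Fin.nontrivial_iff_two_le.2 (by have := i.isLt; omega)
  obtain ⟨j, hj⟩ := exists_ne i
  have h1 := congrArg (Φ.coeff j) h
  rw [coeff_highest_sub hj, coeff_simple_of_ne hj] at h1
  linarith [hμ.one_le_coeff j]

variable {C} in
/-- The `Dᵢ` and `Bᵢ` are linearly independent modulo inner derivations. -/
lemma eq_zero_of_sum_mem (hμ : Φ.IsHighest μ)
    (hm : ∀ i, ¬ Φ.IsPos (μ - (m i + 1) • Φ.simple i)) (hn : n ≠ 1) {a b : Fin n → ℂ}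
    (h : ∑ i, a i • C.D i + ∑ i, b i • C.B μ m hγ i ∈ innerDerivations L) (k : Fin n) :
    a k = 0 ∧ b k = 0 := by
  obtain ⟨x, hx⟩ := h
  have hB : ∑ i, b i • C.B μ m hγ i (C.E (Φ.simple k)) =
      b k • C.E (μ - m k • Φ.simple k) := by
    rw [Finset.sum_eq_single k, C.B_self]
    · intro i _ hik
      rw [C.B_of_ne hγ fun h => hik (Φ.simple_linearIndependent.injective h).symm, smul_zero]
    · simp
  have hk : ⁅x, C.E (Φ.simple k)⁆ =
      a k • C.E (Φ.simple k) + b k • C.E (μ - m k • Φ.simple k) := by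
    have := LinearMap.congr_fun hx (C.E (Φ.simple k))
    simp only [LieHom.coe_toLinearMap, LieAlgebra.ad_apply, LinearMap.add_apply,
      LinearMap.sum_apply, LinearMap.smul_apply, hB] at this
    rw [this]
    simp [D_simple]
  have hne := highest_sub_ne_simple hμ hn k (m k)
  have key : ∀ v, Φ.IsPos v → ¬ Φ.IsPos (v - Φ.simple k) →
      C.coordE v ⁅x, C.E (Φ.simple k)⁆ = 0 := by
    intro v hv hv'
    have := C.coordE_lie_smul v x (isPos_simple k)
    rw [C.E_of_not_isPos hv', smul_zero, zero_lie] at this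
    exact (smul_eq_zero.1 this).resolve_right (C.E_ne_zero hv)
  constructor
  · have h1 := key _ (isPos_simple k) (by rw [sub_self]; exact fun h => ne_zero_of_mem h.1 rfl)
    rw [hk, map_add, map_smul, map_smul, C.coordE_self (isPos_simple k), C.coordE_of_ne hne] at h1
    simpa using h1
  · have h1 := key _ (hγ k) (by rw [sub_sub, ← succ_nsmul]; exact hm k)
    rw [hk, map_add, map_smul, map_smul, C.coordE_self (hγ k), C.coordE_of_ne hne.symm] at h1
    simpa using h1

omit C in
lemma lie_mem_innerDerivations {T S : Module.End ℂ L} (hT : T ∈ innerDerivations L)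
    (hS : IsLieDerivation S) : ⁅T, S⁆ ∈ innerDerivations L := by
  obtain ⟨x, rfl⟩ := hT
  exact ⟨-S x, by
    simp only [LieHom.coe_toLinearMap, lie_ad_of_isLieDerivation hS, map_neg]⟩

omit C in
lemma lie_mem_innerDerivations_right {T S : Module.End ℂ L} (hT : IsLieDerivation T)
    (hS : S ∈ innerDerivations L) : ⁅T, S⁆ ∈ innerDerivations L := by
  rw [← lie_skew]
  exact neg_mem (lie_mem_innerDerivations hS hT)

omit C in
lemma isLieDerivation_lie {T S : Module.End ℂ L} (hT : IsLieDerivation T)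
    (hS : IsLieDerivation S) : IsLieDerivation ⁅T, S⁆ := by
  intro x y
  simp only [LieRing.of_associative_ring_bracket, LinearMap.sub_apply, Module.End.mul_apply,
    hT _ _, hS _ _, map_add, sub_lie, lie_sub]
  abel

variable {C} in
lemma IsHomogeneous.lie {T S : Module.End ℂ L} {ω ξ : V} (hT : C.IsHomogeneous ω T)
    (hS : C.IsHomogeneous ξ S) : C.IsHomogeneous (ω + ξ) ⁅T, S⁆ := by
  have key : ∀ {T S : Module.End ℂ L} {ω ξ : V}, C.IsHomogeneous ω T → C.IsHomogeneous ξ S →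
      ∀ β, Φ.IsPos β → ∃ c : ℂ, T (S (C.E β)) = c • C.E (β + (ω + ξ)) := by
    intro T S ω ξ hT hS β hβ
    obtain ⟨c, hc⟩ := hS β hβ
    by_cases hp : Φ.IsPos (β + ξ)
    · obtain ⟨d, hd⟩ := hT _ hp
      exact ⟨c * d, by rw [hc, map_smul, hd, smul_smul, add_assoc, add_comm ξ]⟩
    · exact ⟨0, by simp [hc, C.E_of_not_isPos hp]⟩
  intro β hβ
  obtain ⟨c, hc⟩ := key hT hS β hβ
  obtain ⟨d, hd⟩ := key hS hT β hβ
  rw [add_comm ξ] at hd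
  exact ⟨c - d, by
    simp only [LieRing.of_associative_ring_bracket, LinearMap.sub_apply, Module.End.mul_apply]
    rw [hc, hd, sub_smul]⟩

lemma lie_D_D (i j : Fin n) : ⁅C.D i, C.D j⁆ = 0 := by
  refine C.hom_ext fun β hβ => ?_
  simp only [LieRing.of_associative_ring_bracket, LinearMap.sub_apply, Module.End.mul_apply,
    C.D_E _ hβ, map_smul, LinearMap.zero_apply]
  module

lemma lie_D_B (i j : Fin n) : ∃ c : ℂ, ⁅C.D i, C.B μ m hγ j⁆ = c • C.B μ m hγ j := by
  refine ⟨Φ.coord (μ - m j • Φ.simple j) i - Φ.coord (Φ.simple j) i, C.hom_ext fun β hβ => ?_⟩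
  simp only [LieRing.of_associative_ring_bracket, LinearMap.sub_apply, Module.End.mul_apply,
    LinearMap.smul_apply, C.D_E _ hβ, map_smul]
  by_cases h : β = Φ.simple j
  · subst h
    rw [C.B_self, C.D_E _ (hγ j), sub_smul]
  · rw [C.B_of_ne hγ h]
    simp

omit C in
/-- If the `αᵢ`-string and the `αⱼ`-string through the highest root start at the other simple
root, then the root system is of type `A₂`. -/
lemma card_eq_six (hμ : Φ.IsHighest μ) (hn : n ≠ 1) {i j : Fin n} {k l : ℕ}
    (hi : μ - k • Φ.simple i = Φ.simple j) (hj : μ - l • Φ.simple j = Φ.simple i) :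
    n = 2 ∧ Φ.R.card = 6 := by
  have hij : i ≠ j := by
    rintro rfl
    exact highest_sub_ne_simple hμ hn _ _ hi
  have huniv : ∀ a, a = i ∨ a = j := by
    intro a
    by_contra! h
    have := congrArg (Φ.coeff a) hi
    rw [coeff_highest_sub h.1, coeff_simple_of_ne h.2] at this
    linarith [hμ.one_le_coeff a]
  have hci : Φ.coeff i μ = 1 := by
    rw [← coeff_highest_sub hij l, hj, coeff_simple_self]
  have hcj : Φ.coeff j μ = 1 := by
    rw [← coeff_highest_sub hij.symm k, hi, coeff_simple_self]
  constructor
  · have : (Finset.univ : Finset (Fin n)) = {i, j} := by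
      ext a; simpa using huniv a
    simpa [Finset.card_pair hij] using congrArg Finset.card this
  have hinj : Set.InjOn (fun β => (Φ.coord β i, Φ.coord β j)) (Φ.R : Set V) := by
    intro β hβ δ hδ h
    simp only [Prod.mk.injEq] at h
    refine Φ.coeff_ext fun a => ?_
    rw [coeff_root hβ, coeff_root hδ]
    rcases huniv a with rfl | rfl
    · rw [h.1]
    · rw [h.2]
  have hcoord : ∀ {β : V} (_ : β ∈ Φ.R) {a b : ℤ}, Φ.coeff i β = a → Φ.coeff j β = b →
      (Φ.coord β i, Φ.coord β j) = (a, b) := by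
    intro β hβ a b h1 h2
    rw [coeff_root hβ] at h1 h2
    rw [Int.cast_injective h1, Int.cast_injective h2]
  have himg : Φ.R.image (fun β => (Φ.coord β i, Φ.coord β j)) =
      ({(1, 0), (0, 1), (1, 1), (-1, 0), (0, -1), (-1, -1)} : Finset (ℤ × ℤ)) := by
    apply Finset.Subset.antisymm
    · intro p hp
      obtain ⟨β, hβ, rfl⟩ := Finset.mem_image.1 hp
      have hne : ¬ (Φ.coord β i = 0 ∧ Φ.coord β j = 0) := by
        intro h
        refine ne_zero_of_mem hβ (Φ.coeff_ext fun a => ?_)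
        rw [coeff_root hβ, map_zero]
        rcases huniv a with rfl | rfl
        · rw [h.1, Int.cast_zero]
        · rw [h.2, Int.cast_zero]
      have hle : ∀ β, Φ.IsPos β → Φ.coord β i ≤ 1 ∧ Φ.coord β j ≤ 1 := by
        intro β hβ
        have h1 := hμ.coeff_le hβ i
        have h2 := hμ.coeff_le hβ j
        rw [coeff_root hβ.1, hci] at h1
        rw [coeff_root hβ.1, hcj] at h2
        exact ⟨by exact_mod_cast h1, by exact_mod_cast h2⟩
      have hneg : ∀ a, Φ.coord (-β) a = -Φ.coord β a := by
        intro a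
        have := map_neg (Φ.coeff a) β
        rw [coeff_root hβ, coeff_root (RootSystemBase.neg_mem hβ)] at this
        exact_mod_cast this
      simp only [Finset.mem_insert, Finset.mem_singleton, Prod.mk.injEq]
      rcases Φ.coord_sign β hβ with h | h
      · have := hle β ⟨hβ, h⟩
        have := h i
        have := h j
        omega
      · have := hle (-β) ⟨RootSystemBase.neg_mem hβ, fun a => by rw [hneg]; have := h a; omega⟩
        rw [hneg, hneg] at this
        have := h i
        have := h j
        omega
    · have hmem : ∀ (β : V) (_ : β ∈ Φ.R) (a b : ℤ), Φ.coeff i β = a → Φ.coeff j β = b →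
          (a, b) ∈ Φ.R.image (fun β => (Φ.coord β i, Φ.coord β j)) := fun β hβ a b h1 h2 =>
        Finset.mem_image.2 ⟨β, hβ, hcoord hβ h1 h2⟩
      intro p hp
      simp only [Finset.mem_insert, Finset.mem_singleton] at hp
      rcases hp with rfl | rfl | rfl | rfl | rfl | rfl
      · exact hmem _ (Φ.simple_mem i) _ _ (by simp [coeff_simple_self])
          (by simp [coeff_simple_of_ne hij.symm])
      · exact hmem _ (Φ.simple_mem j) _ _ (by simp [coeff_simple_of_ne hij])
          (by simp [coeff_simple_self])
      · exact hmem _ hμ.1.1 _ _ (by simp [hci]) (by simp [hcj])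
      · exact hmem _ (RootSystemBase.neg_mem (Φ.simple_mem i)) _ _ (by simp [coeff_simple_self])
          (by simp [coeff_simple_of_ne hij.symm])
      · exact hmem _ (RootSystemBase.neg_mem (Φ.simple_mem j)) _ _
          (by simp [coeff_simple_of_ne hij]) (by simp [coeff_simple_self])
      · exact hmem _ (RootSystemBase.neg_mem hμ.1.1) _ _ (by simp [hci]) (by simp [hcj])
  rw [← Finset.card_image_of_injOn hinj, himg]
  rfl

lemma B_B_simple {i j k : Fin n}
    (h : C.B μ m hγ i (C.B μ m hγ j (C.E (Φ.simple k))) ≠ 0) :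
    k = j ∧ μ - m j • Φ.simple j = Φ.simple i := by
  have hkj : k = j := by
    by_contra hkj
    rw [C.B_of_ne hγ fun h => hkj (Φ.simple_linearIndependent.injective h), map_zero] at h
    exact h rfl
  subst hkj
  refine ⟨rfl, ?_⟩
  by_contra hne
  rw [C.B_self, C.B_of_ne hγ hne] at h
  exact h rfl

lemma lie_B_B_mem (hμ : Φ.IsHighest μ)
    (hm : ∀ i, (∀ k : ℕ, k ≤ m i → Φ.IsPos (μ - k • Φ.simple i)) ∧
      ¬ Φ.IsPos (μ - (m i + 1) • Φ.simple i)) (hn : n ≠ 1) (hA2 : ¬ (n = 2 ∧ Φ.R.card = 6))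
    (i j : Fin n) : ⁅C.B μ m hγ i, C.B μ m hγ j⁆ ∈ innerDerivations L := by
  have hT := isLieDerivation_lie (C.isLieDerivation_B hγ hμ i) (C.isLieDerivation_B hγ hμ j)
  have hTω := (C.isHomogeneous_B hγ i).lie (C.isHomogeneous_B hγ j)
  by_cases hex : ∃ k, ⁅C.B μ m hγ i, C.B μ m hγ j⁆ (C.E (Φ.simple k)) ≠ 0
  swap
  · push Not at hex
    rw [C.eq_zero_of_simple hT hex]
    exact zero_mem _
  obtain ⟨k, hk⟩ := hex
  have hcases : (k = j ∧ μ - m j • Φ.simple j = Φ.simple i) ∨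
      (k = i ∧ μ - m i • Φ.simple i = Φ.simple j) := by
    by_contra! h
    apply hk
    rw [LieRing.of_associative_ring_bracket, LinearMap.sub_apply, Module.End.mul_apply,
      Module.End.mul_apply, sub_eq_zero]
    have h1 := fun h' => (h.1 (C.B_B_simple hγ (i := i) (j := j) (k := k) h').1)
      (C.B_B_simple hγ h').2
    have h2 := fun h' => (h.2 (C.B_B_simple hγ (i := j) (j := i) (k := k) h').1)
      (C.B_B_simple hγ h').2
    rw [not_not.1 h1, not_not.1 h2]
  by_cases hωR : μ - m i • Φ.simple i - Φ.simple i + (μ - m j • Φ.simple j - Φ.simple j) ∈ Φ.R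
  · exact mem_innerDerivations_of_mem hT hTω hωR
  exfalso
  by_cases hω0 : μ - m i • Φ.simple i - Φ.simple i + (μ - m j • Φ.simple j - Φ.simple j) = 0
  · refine hA2 ?_
    rcases hcases with ⟨-, h⟩ | ⟨-, h⟩
    · refine card_eq_six hμ hn (i := i) (j := j) (k := m i) (l := m j) ?_ h
      rw [h] at hω0
      rw [← sub_eq_zero, ← hω0]
      abel
    · refine card_eq_six hμ hn (i := i) (j := j) (k := m i) (l := m j) h ?_
      rw [h] at hω0
      rw [← sub_eq_zero, ← hω0]
      abel
  · obtain ⟨c, hc⟩ := C.eq_smul_B hγ hμ hm hT hTω hω0 hωR hk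
    obtain ⟨d, hd⟩ := hTω _ (isPos_simple k)
    rw [hd] at hk
    have hp := C.isPos_of_smul_E_ne_zero hk
    have hw : μ - m k • Φ.simple k = Φ.simple k + (μ - m i • Φ.simple i - Φ.simple i +
        (μ - m j • Φ.simple j - Φ.simple j)) := by
      by_contra hne
      have h1 := congrArg (C.coordE (Φ.simple k + (μ - m i • Φ.simple i - Φ.simple i +
        (μ - m j • Φ.simple j - Φ.simple j)))) hd
      rw [hc, LinearMap.smul_apply, C.B_self, map_smul, map_smul, C.coordE_of_ne hne,
        C.coordE_self hp, smul_zero, smul_eq_mul, mul_one] at h1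
      exact hk (by rw [← h1, zero_smul])
    rcases hcases with ⟨rfl, -⟩ | ⟨rfl, -⟩
    · refine highest_sub_ne_simple hμ hn i (m i) (sub_eq_zero.1 ?_)
      rw [← sub_eq_zero.2 hw.symm]
      abel
    · refine highest_sub_ne_simple hμ hn j (m j) (sub_eq_zero.1 ?_)
      rw [← sub_eq_zero.2 hw.symm]
      abel

end B

omit C in
lemma lie_mem_of_mem_span {X Y : Set (Module.End ℂ L)} {K : Submodule ℂ (Module.End ℂ L)}
    (h : ∀ T ∈ X, ∀ S ∈ Y, ⁅T, S⁆ ∈ K) {T S : Module.End ℂ L} (hT : T ∈ Submodule.span ℂ X)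
    (hS : S ∈ Submodule.span ℂ Y) : ⁅T, S⁆ ∈ K := by
  induction hT using Submodule.span_induction with
  | mem T hT =>
    induction hS using Submodule.span_induction with
    | mem S hS => exact h T hT S hS
    | zero => rw [lie_zero]; exact zero_mem _
    | add S S' _ _ h1 h2 => rw [lie_add]; exact add_mem h1 h2
    | smul c S _ h1 => rw [lie_smul]; exact K.smul_mem c h1
  | zero => rw [zero_lie]; exact zero_mem _
  | add T T' _ _ h1 h2 => rw [add_lie]; exact add_mem h1 h2
  | smul c T _ h1 => rw [smul_lie]; exact K.smul_mem c h1

end ChevalleyNilradical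

/-- If `𝔤` is not of type `A₁` or `A₂` (i.e. `𝔤 ≠ 𝔰𝔩(2), 𝔰𝔩(3)`;
equivalently the rank is not `1`, and `𝔤` is not of rank `2` with exactly `6` roots),
then `Out(𝔫) = Der(𝔫)/ad(𝔫)` is a `2n`-dimensional solvable Lie algebra: its derived
algebra is contained in the abelian subalgebra spanned by the classes of `B₁, …, Bₙ`;
in particular `Out(𝔫)` is two-step solvable. -/
theorem Out_solvable
    {n : ℕ} {V : Type*} [NormedAddCommGroup V] [InnerProductSpace ℝ V]
    (Φ : RootSystemBase n V) (L : Type*) [LieRing L] [LieAlgebra ℂ L]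
    (C : ChevalleyNilradical Φ L) (μ : V) (hμ : Φ.IsHighest μ) (m : Fin n → ℕ)
    (hm : ∀ i, (∀ k : ℕ, k ≤ m i → Φ.IsPos (μ - k • Φ.simple i)) ∧
      ¬ Φ.IsPos (μ - (m i + 1) • Φ.simple i))
    (hγ : ∀ i, Φ.IsPos (μ - m i • Φ.simple i))
    (hnotA1 : n ≠ 1) (hnotA2 : ¬ (n = 2 ∧ Φ.R.card = 6)) :
    -- `Out(𝔫)` is `2n`-dimensional
    Module.finrank ℂ
      (↥(derivations L) ⧸
        Submodule.comap (derivations L).subtype (innerDerivations L)) = 2 * n ∧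
    -- the derived algebra of `Out(𝔫)` is contained in the span of the classes of the `Bᵢ`
    (∀ T S : Module.End ℂ L, IsLieDerivation T → IsLieDerivation S →
      ⁅T, S⁆ ∈ innerDerivations L ⊔ Submodule.span ℂ (Set.range (C.B μ m hγ))) ∧
    -- that span is abelian modulo inner derivations …
    (∀ i j : Fin n, ⁅C.B μ m hγ i, C.B μ m hγ j⁆ ∈ innerDerivations L) ∧
    -- … so `Out(𝔫)` is two-step solvable
    (∀ T S T' S' : Module.End ℂ L, IsLieDerivation T → IsLieDerivation S →
      IsLieDerivation T' → IsLieDerivation S' →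
      ⁅⁅T, S⁆, ⁅T', S'⁆⁆ ∈ innerDerivations L) := by
  have hn := hnotA1
  have hD := C.isLieDerivation_D
  have hB := C.isLieDerivation_B hγ hμ
  have hBB := C.lie_B_B_mem hγ hμ hm hn hnotA2
  have hspan : ∀ T : Module.End ℂ L, IsLieDerivation T →
      T ∈ innerDerivations L ⊔ Submodule.span ℂ (Set.range (C.B μ m hγ)) ⊔
        Submodule.span ℂ (Set.range C.D) := fun T hT =>
    ChevalleyNilradical.mem_sup_span hγ hμ hm hT
  have hinner : ∀ T ∈ innerDerivations L, IsLieDerivation T := by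
    rintro _ ⟨x, rfl⟩
    exact ChevalleyNilradical.isLieDerivation_ad x
  have hlie : ∀ T S : Module.End ℂ L, IsLieDerivation T → IsLieDerivation S →
      ⁅T, S⁆ ∈ innerDerivations L ⊔ Submodule.span ℂ (Set.range (C.B μ m hγ)) := by
    intro T S hT hS
    have hX : innerDerivations L ⊔ Submodule.span ℂ (Set.range (C.B μ m hγ)) ⊔
        Submodule.span ℂ (Set.range C.D) = Submodule.span ℂ
          ((innerDerivations L : Set (Module.End ℂ L)) ∪ Set.range (C.B μ m hγ) ∪
            Set.range C.D) := by
      rw [Submodule.span_union, Submodule.span_union, Submodule.span_eq]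
    have hDB : ∀ i j, ⁅C.D i, C.B μ m hγ j⁆ ∈
        innerDerivations L ⊔ Submodule.span ℂ (Set.range (C.B μ m hγ)) := by
      intro i j
      obtain ⟨c, hc⟩ := C.lie_D_B hγ i j
      rw [hc]
      exact Submodule.mem_sup_right (Submodule.smul_mem _ _ (Submodule.subset_span ⟨j, rfl⟩))
    refine ChevalleyNilradical.lie_mem_of_mem_span ?_ (hX ▸ hspan T hT) (hX ▸ hspan S hS)
    rintro T ((hT | ⟨i, rfl⟩) | ⟨i, rfl⟩) S ((hS | ⟨j, rfl⟩) | ⟨j, rfl⟩)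
    · exact Submodule.mem_sup_left
        (ChevalleyNilradical.lie_mem_innerDerivations hT (hinner S hS))
    · exact Submodule.mem_sup_left (ChevalleyNilradical.lie_mem_innerDerivations hT (hB j))
    · exact Submodule.mem_sup_left (ChevalleyNilradical.lie_mem_innerDerivations hT (hD j))
    · exact Submodule.mem_sup_left (ChevalleyNilradical.lie_mem_innerDerivations_right (hB i) hS)
    · exact Submodule.mem_sup_left (hBB i j)
    · rw [← lie_skew]
      exact neg_mem (hDB j i)
    · exact Submodule.mem_sup_left (ChevalleyNilradical.lie_mem_innerDerivations_right (hD i) hS)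
    · exact hDB i j
    · rw [C.lie_D_D]
      exact zero_mem _
  refine ⟨?_, hlie, hBB, ?_⟩
  · set P := Submodule.comap (derivations L).subtype (innerDerivations L) with hP
    let d : Fin n ⊕ Fin n → derivations L :=
      Sum.elim (fun i => ⟨C.D i, hD i⟩) fun i => ⟨C.B μ m hγ i, hB i⟩
    have hli : LinearIndependent ℂ (P.mkQ ∘ d) := by
      rw [Fintype.linearIndependent_iff]
      intro g hg
      have hmem : ∑ i, g (.inl i) • C.D i + ∑ i, g (.inr i) • C.B μ m hγ i ∈
          innerDerivations L := by
        have h1 : P.mkQ (∑ s, g s • d s) = 0 := by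
          rw [map_sum, ← hg]
          simp
        rw [Submodule.mkQ_apply, Submodule.Quotient.mk_eq_zero, hP, Submodule.mem_comap] at h1
        simpa [d, Fintype.sum_sum_type] using h1
      have h0 := ChevalleyNilradical.eq_zero_of_sum_mem hγ hμ (fun i => (hm i).2) hn hmem
      rintro (i | i)
      · exact (h0 i).1
      · exact (h0 i).2
    have htop : ⊤ ≤ Submodule.span ℂ (Set.range (P.mkQ ∘ d)) := by
      rintro q -
      obtain ⟨⟨T, hT⟩, rfl⟩ := P.mkQ_surjective q
      obtain ⟨U, hU, Z, hZ, hUZ⟩ := Submodule.mem_sup.1 (hspan T hT)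
      obtain ⟨X, hX, Y, hY, hXY⟩ := Submodule.mem_sup.1 hU
      obtain ⟨b, rfl⟩ := (Submodule.mem_span_range_iff_exists_fun ℂ).1 hY
      obtain ⟨a, rfl⟩ := (Submodule.mem_span_range_iff_exists_fun ℂ).1 hZ
      have h1 : P.mkQ ⟨T, hT⟩ = ∑ s, Sum.elim a b s • (P.mkQ ∘ d) s := by
        have h2 : (⟨T, hT⟩ : derivations L) = ⟨X, hinner X hX⟩ + ∑ s, Sum.elim a b s • d s := by
          apply Subtype.ext
          simp only [Fintype.sum_sum_type, d, Submodule.coe_add, Submodule.coe_sum,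
            Submodule.coe_smul, Sum.elim_inl, Sum.elim_inr]
          rw [← hUZ, ← hXY]
          abel
        have h3 : P.mkQ ⟨X, hinner X hX⟩ = 0 := by
          rw [Submodule.mkQ_apply, Submodule.Quotient.mk_eq_zero]
          exact hX
        rw [h2, map_add, h3, zero_add, map_sum]
        simp
      rw [h1]
      exact Submodule.sum_mem _ fun s _ =>
        Submodule.smul_mem _ _ (Submodule.subset_span ⟨s, rfl⟩)
    rw [Module.finrank_eq_card_basis (Module.Basis.mk hli htop)]
    simp [two_mul]
  · intro T S T' S' hT hS hT' hS'
    have hX : innerDerivations L ⊔ Submodule.span ℂ (Set.range (C.B μ m hγ)) = Submodule.span ℂ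
        ((innerDerivations L : Set (Module.End ℂ L)) ∪ Set.range (C.B μ m hγ)) := by
      rw [Submodule.span_union, Submodule.span_eq]
    refine ChevalleyNilradical.lie_mem_of_mem_span ?_ (hX ▸ hlie T S hT hS)
      (hX ▸ hlie T' S' hT' hS')
    rintro T (hT | ⟨i, rfl⟩) S (hS | ⟨j, rfl⟩)
    · exact ChevalleyNilradical.lie_mem_innerDerivations hT (hinner S hS)
    · exact ChevalleyNilradical.lie_mem_innerDerivations hT (hB j)
    · exact ChevalleyNilradical.lie_mem_innerDerivations_right (hB i) hS
    · exact hBB i j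
end

section
/- For 𝔤 the simple complex Lie algebra of type G₂ and 𝔫 its 6-dimensional maximal nilpotent subalgebra, the adjoint Chevalley–Eilenberg cohomology has dimensions dim H⁰(𝔫;𝔫) = 1, dim H¹(𝔫;𝔫) = 4, dim H²(𝔫;𝔫) = 7, dim H³(𝔫;𝔫) = 8, dim H⁴(𝔫;𝔫) = 7, dim H⁵(𝔫;𝔫) = 5, dim H⁶(𝔫;𝔫) = 2. -/
namespace CE

variable {L : Type*} [LieRing L] [LieAlgebra ℂ L]

/-- The Chevalley–Eilenberg differential on `k`-cochains with values in the adjoint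
module, written for an arbitrary function on tuples:
`(dc)(x₀,…,x_m) = Σᵢ (−1)^i ⁅xᵢ, c(x₀,…,x̂ᵢ,…,x_m)⁆
  + Σ_{i<j} (−1)^{i+j} c(⁅xᵢ,xⱼ⁆, x₀,…,x̂ᵢ,…,x̂ⱼ,…,x_m)`.
In the second sum we substitute `⁅xᵢ,xⱼ⁆` in slot `i` after deleting slot `j`, with the
sign `(−1)^j`; for alternating `c` this agrees with the usual formula, since moving
`⁅xᵢ,xⱼ⁆` from the front into slot `i` costs the sign `(−1)^i`. -/
noncomputable def ceDiffFun {m : ℕ} (c : (Fin m → L) → L) : (Fin (m + 1) → L) → L :=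
  fun x =>
    (∑ i : Fin (m + 1), (-1 : ℂ) ^ (i : ℕ) • ⁅x i, c (i.removeNth x)⁆) +
    ∑ j : Fin (m + 1), ∑ i : Fin (m + 1),
      if h : (i : ℕ) < (j : ℕ) then
        (-1 : ℂ) ^ (j : ℕ) •
          c (Function.update (j.removeNth x)
              ⟨(i : ℕ), h.trans_le (Nat.lt_succ_iff.mp j.isLt)⟩ ⁅x i, x j⁆)
      else 0

variable (L)

/-- The space `Z^k(𝔫;𝔫)` of Chevalley–Eilenberg cocycles.  (The set of alternating
cochains killed by the differential is a linear subspace, so it coincides with the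
supremum of all submodules contained in it.) -/
noncomputable def cocycles (k : ℕ) : Submodule ℂ (AlternatingMap ℂ L L (Fin k)) :=
  sSup {p | (p : Set (AlternatingMap ℂ L L (Fin k))) ⊆ {c | ∀ x, ceDiffFun ⇑c x = 0}}

/-- The space `B^{k+1}(𝔫;𝔫)` of Chevalley–Eilenberg coboundaries.  (The image of the
differential is a linear subspace, so taking the span adds nothing.) -/
noncomputable def coboundaries (k : ℕ) : Submodule ℂ (AlternatingMap ℂ L L (Fin (k + 1))) :=
  Submodule.span ℂ
    {c | ∃ u : AlternatingMap ℂ L L (Fin k), ∀ x, c x = ceDiffFun ⇑u x}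

/-- `H⁰(𝔫;𝔫) = Z⁰(𝔫;𝔫)`. -/
noncomputable abbrev H0 : Type _ := ↥(cocycles L 0)

/-- `H^{k+1}(𝔫;𝔫) = Z^{k+1}(𝔫;𝔫) / B^{k+1}(𝔫;𝔫)`. -/
noncomputable abbrev Hsucc (k : ℕ) : Type _ :=
  ↥(cocycles L (k + 1)) ⧸
    Submodule.comap (cocycles L (k + 1)).subtype (coboundaries L k)

end CE

/-- The 6-dimensional maximal nilpotent subalgebra `𝔫 = ⊕_{α ∈ R⁺} 𝔤_α` of the simple
complex Lie algebra of type `G₂`, presented by a Chevalley basis of root vectors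
`e 0 = e_{1,0}`, `e 1 = e_{0,1}`, `e 2 = e_{1,1}`, `e 3 = e_{1,2}`, `e 4 = e_{1,3}`,
`e 5 = e_{2,3}` (indexed by the six positive roots `(A₁, A₂)` of `G₂`), with the
Chevalley structure constants below (all other brackets of basis vectors vanish, as the
corresponding sums of roots are not roots). -/
structure G2NilradicalBasis (L : Type*) [LieRing L] [LieAlgebra ℂ L] where
  /-- the root vectors, a basis of `𝔫` -/
  e : Module.Basis (Fin 6) ℂ L
  lie_01 : ⁅e 0, e 1⁆ = -e 2
  lie_12 : ⁅e 1, e 2⁆ = (2 : ℂ) • e 3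
  lie_13 : ⁅e 1, e 3⁆ = (3 : ℂ) • e 4
  lie_04 : ⁅e 0, e 4⁆ = e 5
  lie_23 : ⁅e 2, e 3⁆ = -((3 : ℂ) • e 5)
  lie_02 : ⁅e 0, e 2⁆ = 0
  lie_03 : ⁅e 0, e 3⁆ = 0
  lie_05 : ⁅e 0, e 5⁆ = 0
  lie_14 : ⁅e 1, e 4⁆ = 0
  lie_15 : ⁅e 1, e 5⁆ = 0
  lie_24 : ⁅e 2, e 4⁆ = 0
  lie_25 : ⁅e 2, e 5⁆ = 0
  lie_34 : ⁅e 3, e 4⁆ = 0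
  lie_35 : ⁅e 3, e 5⁆ = 0
  lie_45 : ⁅e 4, e 5⁆ = 0


namespace CE

variable {L : Type*} [LieRing L] [LieAlgebra ℂ L]

theorem sum_map_update_eq_zero {k : ℕ} (u : L [⋀^Fin k]→ₗ[ℂ] L) (A : L → L) {y : Fin k → L}
    {p q : Fin k} (hpq : y p = y q) (hne : p ≠ q) :
    ∑ i, u (Function.update y i (A (y i))) = 0 := by
  rw [Fintype.sum_eq_add p q hne]
  · have hswap : Function.update y q (A (y q)) =
        Function.update y p (A (y p)) ∘ Equiv.swap p q := by
      funext r
      rcases eq_or_ne r p with rfl | hrp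
      · simp [Function.update_of_ne hne, Function.update_of_ne hne.symm, hpq]
      rcases eq_or_ne r q with rfl | hrq
      · simp [hpq]
      · simp [Equiv.swap_apply_of_ne_of_ne hrp hrq, hrp, hrq]
    rw [hswap, u.map_swap _ hne, add_neg_cancel]
  · rintro i ⟨hip, hiq⟩
    apply u.map_eq_zero_of_eq _ _ hne
    rw [Function.update_of_ne hip.symm, Function.update_of_ne hiq.symm, hpq]

/-- The action of a Lie algebra element `x` on alternating maps by derivations in the
arguments, `y ↦ ∑ i, u (y₀, …, ⁅x, yᵢ⁆, …)`. -/
noncomputable def argAction {k : ℕ} (u : L [⋀^Fin k]→ₗ[ℂ] L) (x : L) : L [⋀^Fin k]→ₗ[ℂ] L where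
  toMultilinearMap := ∑ i : Fin k, u.toMultilinearMap.compLinearMap
    (Function.update (fun _ => LinearMap.id) i (LieAlgebra.ad ℂ L x))
  map_eq_zero_of_eq' y p q hpq hne := by
    refine Eq.trans ?_ (sum_map_update_eq_zero u (LieAlgebra.ad ℂ L x) hpq hne)
    simp only [MultilinearMap.toFun_eq_coe, sum_apply]
    refine Finset.sum_congr rfl fun i _ => congrArg u ?_
    funext j
    rcases eq_or_ne j i with rfl | hji
    · simp
    · simp [hji]

theorem argAction_apply {k : ℕ} (u : L [⋀^Fin k]→ₗ[ℂ] L) (x : L) (y : Fin k → L) :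
    argAction u x y = ∑ i, u (Function.update y i ⁅x, y i⁆) := by
  change (∑ i : Fin k, u.toMultilinearMap.compLinearMap
    (Function.update (fun _ => LinearMap.id) i (LieAlgebra.ad ℂ L x))) y = _
  rw [sum_apply]
  refine Finset.sum_congr rfl fun i _ => congrArg u ?_
  funext j
  rcases eq_or_ne j i with rfl | hji
  · simp
  · simp [hji]

/-- `argAction` as a linear map in the Lie algebra element. -/
noncomputable def argActionLM {k : ℕ} (u : L [⋀^Fin k]→ₗ[ℂ] L) : L →ₗ[ℂ] L [⋀^Fin k]→ₗ[ℂ] L where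
  toFun := argAction u
  map_add' x x' := by
    ext y
    simp [argAction_apply, Finset.sum_add_distrib]
  map_smul' c x := by
    ext y
    simp [argAction_apply, Finset.smul_sum]

/-- Composition of an alternating map with the adjoint action on values. -/
noncomputable def valAction {k : ℕ} (u : L [⋀^Fin k]→ₗ[ℂ] L) : L →ₗ[ℂ] L [⋀^Fin k]→ₗ[ℂ] L where
  toFun x := LinearMap.compAlternatingMap (LieAlgebra.ad ℂ L x) u
  map_add' x x' := by
    ext y
    simp
  map_smul' c x := by
    ext y
    simp

theorem map_removeNth_update_lie_symm {k : ℕ} (u : L [⋀^Fin k]→ₗ[ℂ] L) (x : Fin (k + 1) → L)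
    {i j : Fin (k + 1)} (hij : i ≠ j) :
    (-1 : ℂ) ^ (j : ℕ) • u (j.removeNth (Function.update x i ⁅x j, x i⁆)) =
      (-1 : ℂ) ^ (i : ℕ) • u (i.removeNth (Function.update x j ⁅x i, x j⁆)) := by
  have key := u.neg_one_pow_smul_map_removeNth_add_eq_zero_of_eq
    (v := Function.update (Function.update x i ⁅x j, x i⁆) j ⁅x j, x i⁆) (i := i) (j := j)
    (by simp [hij]) hij
  rw [Fin.removeNth_update, Function.update_comm hij, Fin.removeNth_update] at key
  have hneg : u (i.removeNth (Function.update x j ⁅x i, x j⁆)) =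
      -u (i.removeNth (Function.update x j ⁅x j, x i⁆)) := by
    obtain ⟨j, rfl⟩ := Fin.exists_succAbove_eq hij.symm
    simp only [Fin.removeNth_update_succAbove]
    rw [← lie_skew, u.map_update_neg]
  rw [hneg, smul_neg]
  have e : ∀ (n : ℕ) (z : L), (-1 : ℂ) ^ n • z = (-1 : ℤ) ^ n • z := fun n z => by
    rcases Nat.even_or_odd n with h | h <;> simp [h.neg_one_pow]
  rw [e, e]
  exact eq_neg_of_add_eq_zero_right key

theorem two_smul_sum_lt {k : ℕ} {M : Type*} [AddCommMonoid M] (G : Fin k → Fin k → M)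
    (hG : ∀ i j, G i j = G j i) (h0 : ∀ i, G i i = 0) :
    ∑ j, ∑ i, G j i = 2 • ∑ j : Fin k, ∑ i : Fin k, if (i : ℕ) < (j : ℕ) then G j i else 0 := by
  have hsplit : ∀ j i, G j i = (if (i : ℕ) < (j : ℕ) then G j i else 0) +
      if (j : ℕ) < (i : ℕ) then G i j else 0 := fun j i => by
    rcases lt_trichotomy i j with h | rfl | h
    · simp [h, h.not_gt]
    · simp [h0]
    · simp [h, h.not_gt, hG i j]
  rw [two_nsmul]
  conv_lhs => enter [2, j, 2, i]; rw [hsplit]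
  simp only [Finset.sum_add_distrib]
  congr 1
  exact Finset.sum_comm

theorem alternatizeUncurryFin_argActionLM_apply {k : ℕ} (u : L [⋀^Fin k]→ₗ[ℂ] L)
    (x : Fin (k + 1) → L) :
    AlternatingMap.alternatizeUncurryFin (argActionLM u) x =
      ∑ j : Fin (k + 1), ∑ i : Fin (k + 1), if i = j then 0 else
        (-1 : ℂ) ^ (j : ℕ) • u (j.removeNth (Function.update x i ⁅x j, x i⁆)) := by
  rw [AlternatingMap.alternatizeUncurryFin_apply]
  refine Finset.sum_congr rfl fun j _ => ?_
  rw [Fin.sum_univ_succAbove _ j, if_pos rfl, zero_add]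
  change (-1 : ℤ) ^ (j : ℕ) • argAction u (x j) (j.removeNth x) = _
  rw [argAction_apply, Finset.smul_sum]
  refine Finset.sum_congr rfl fun i _ => ?_
  rw [if_neg (Fin.succAbove_ne j i), Fin.removeNth_update_succAbove]
  rcases Nat.even_or_odd (j : ℕ) with h | h <;> simp [h.neg_one_pow, Fin.removeNth]

/-- The Chevalley–Eilenberg differential of an alternating map, as an alternating map. -/
noncomputable def ceDiffAlt {k : ℕ} (u : L [⋀^Fin k]→ₗ[ℂ] L) : L [⋀^Fin (k + 1)]→ₗ[ℂ] L :=
  AlternatingMap.alternatizeUncurryFin (valAction u) -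
    (2⁻¹ : ℂ) • AlternatingMap.alternatizeUncurryFin (argActionLM u)

theorem ceDiffAlt_apply {k : ℕ} (u : L [⋀^Fin k]→ₗ[ℂ] L) (x : Fin (k + 1) → L) :
    ceDiffAlt u x = ceDiffFun u x := by
  rw [ceDiffAlt, AlternatingMap.sub_apply, AlternatingMap.smul_apply,
    alternatizeUncurryFin_argActionLM_apply, two_smul_sum_lt, ceDiffFun, sub_eq_add_neg]
  · congr 1
    · rw [AlternatingMap.alternatizeUncurryFin_apply]
      refine Finset.sum_congr rfl fun i _ => ?_
      rcases Nat.even_or_odd (i : ℕ) with h | h <;> simp [h.neg_one_pow, valAction]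
    · rw [← Nat.cast_smul_eq_nsmul ℂ, smul_smul, Nat.cast_ofNat,
        inv_mul_cancel₀ two_ne_zero, one_smul]
      simp only [← Finset.sum_neg_distrib]
      refine Finset.sum_congr rfl fun j _ => Finset.sum_congr rfl fun i _ => ?_
      split_ifs with hlt heq
      · simp [heq] at hlt
      · have hsucc : j.succAbove ⟨i, hlt.trans_le (Nat.lt_succ_iff.mp j.isLt)⟩ = i :=
          Fin.succAbove_of_castSucc_lt _ _ hlt
        rw [← smul_neg]
        congr 1
        generalize (⟨i, _⟩ : Fin k) = i' at hsucc ⊢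
        subst hsucc
        rw [Fin.removeNth_update_succAbove, ← u.map_update_neg, lie_skew]
      · simp
  · intro i j
    rcases eq_or_ne i j with rfl | hij
    · rfl
    · rw [if_neg hij, if_neg hij.symm, map_removeNth_update_lie_symm u x hij.symm]
  · simp

/-- The Chevalley–Eilenberg differential as a linear map. -/
noncomputable def ceDiff (k : ℕ) : (L [⋀^Fin k]→ₗ[ℂ] L) →ₗ[ℂ] L [⋀^Fin (k + 1)]→ₗ[ℂ] L where
  toFun := ceDiffAlt
  map_add' u v := by
    have hval : valAction (u + v) = valAction u + valAction v := by
      ext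
      simp [valAction]
    have harg : argActionLM (u + v) = argActionLM u + argActionLM v := by
      ext
      simp [argActionLM, argAction_apply, Finset.sum_add_distrib]
    simp only [ceDiffAlt, hval, harg, AlternatingMap.alternatizeUncurryFin_add, smul_add]
    abel
  map_smul' c u := by
    have hval : valAction (c • u) = c • valAction u := by
      ext
      simp [valAction]
    have harg : argActionLM (c • u) = c • argActionLM u := by
      ext
      simp [argActionLM, argAction_apply, Finset.smul_sum]
    simp only [ceDiffAlt, hval, harg, AlternatingMap.alternatizeUncurryFin_smul, smul_sub,
      RingHom.id_apply, smul_comm c]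

theorem ceDiff_apply {k : ℕ} (u : L [⋀^Fin k]→ₗ[ℂ] L) (x : Fin (k + 1) → L) :
    ceDiff k u x = ceDiffFun u x :=
  ceDiffAlt_apply u x

variable (L)

theorem cocycles_eq_ker (k : ℕ) : cocycles L k = LinearMap.ker (ceDiff (L := L) k) := by
  have hker : ∀ c : L [⋀^Fin k]→ₗ[ℂ] L,
      c ∈ LinearMap.ker (ceDiff (L := L) k) ↔ ∀ x, ceDiffFun c x = 0 := fun c => by
    simp [LinearMap.mem_ker, AlternatingMap.ext_iff, ceDiff_apply]
  exact le_antisymm (sSup_le fun p hp c hc => (hker c).2 (hp hc))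
    (le_sSup fun c hc => (hker c).1 hc)

theorem coboundaries_eq_range (k : ℕ) :
    coboundaries L k = LinearMap.range (ceDiff (L := L) k) := by
  have hrange : {c : L [⋀^Fin (k + 1)]→ₗ[ℂ] L | ∃ u : L [⋀^Fin k]→ₗ[ℂ] L,
      ∀ x, c x = ceDiffFun u x} = LinearMap.range (ceDiff (L := L) k) := by
    ext c
    simp [AlternatingMap.ext_iff, ceDiff_apply, eq_comm]
  rw [coboundaries, hrange, Submodule.span_eq]

theorem finite_cochains [Module.Finite ℂ L] (k : ℕ) : Module.Finite ℂ (L [⋀^Fin k]→ₗ[ℂ] L) :=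
  Module.Finite.equiv (exteriorPower.alternatingMapLinearEquiv (R := ℂ) (M := L)).symm

theorem finrank_cochains [Module.Finite ℂ L] (k : ℕ) :
    Module.finrank ℂ (L [⋀^Fin k]→ₗ[ℂ] L) =
      (Module.finrank ℂ L).choose k * Module.finrank ℂ L := by
  rw [(exteriorPower.alternatingMapLinearEquiv (R := ℂ) (M := L)).finrank_eq,
    Module.finrank_linearMap, exteriorPower.finrank_eq]

theorem finrank_Hsucc_add_finrank_cochains [Module.Finite ℂ L] (k : ℕ)
    (hd : LinearMap.range (ceDiff (L := L) k) ≤ LinearMap.ker (ceDiff (L := L) (k + 1))) :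
    Module.finrank ℂ (Hsucc L k) + Module.finrank ℂ (L [⋀^Fin k]→ₗ[ℂ] L) =
      Module.finrank ℂ (LinearMap.ker (ceDiff (L := L) k)) +
        Module.finrank ℂ (LinearMap.ker (ceDiff (L := L) (k + 1))) := by
  have := finite_cochains L k
  have := finite_cochains L (k + 1)
  have hH : Module.finrank ℂ (Hsucc L k) +
      Module.finrank ℂ (LinearMap.range (ceDiff (L := L) k)) =
      Module.finrank ℂ (LinearMap.ker (ceDiff (L := L) (k + 1))) := by
    have hle : coboundaries L k ≤ cocycles L (k + 1) := by
      rwa [cocycles_eq_ker, coboundaries_eq_range]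
    rw [← cocycles_eq_ker, ← coboundaries_eq_range,
      ← (Submodule.comapSubtypeEquivOfLe hle).finrank_eq]
    exact Submodule.finrank_quotient_add_finrank _
  have hrn := LinearMap.finrank_range_add_finrank_ker (ceDiff (L := L) k)
  omega

end CE

namespace IntRows

/-- The entrywise linear combination `a • xs + b • ys`, padding by zeros. -/
def lin (a b : ℤ) : List ℤ → List ℤ → List ℤ
  | [], ys => ys.map (b * ·)
  | x :: xs, [] => (x :: xs).map (a * ·)
  | x :: xs, y :: ys => (a * x + b * y) :: lin a b xs ys

theorem getD_lin (a b : ℤ) (xs ys : List ℤ) (i : ℕ) :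
    (lin a b xs ys).getD i 0 = a * xs.getD i 0 + b * ys.getD i 0 := by
  induction xs generalizing ys i with
  | nil => simp [lin, List.getD_eq_getElem?_getD, List.getElem?_map]; cases ys[i]? <;> simp
  | cons x xs ih =>
    cases ys with
    | nil =>
      simp only [lin, List.getD_eq_getElem?_getD, List.getElem?_map]
      cases (x :: xs)[i]? <;> simp
    | cons y ys =>
      cases i with
      | zero => simp [lin]
      | succ i => simpa [lin] using ih ys i

/-- The number of pivots found in the first `n` columns by fraction-free Gaussian
elimination. -/
def elim : ℕ → List (List ℤ) → ℕ
  | 0, _ => 0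
  | n + 1, rows =>
    match rows.find? fun r => r.headD 0 ≠ 0 with
    | none => elim n (rows.map List.tail)
    | some p => elim n (rows.map fun r =>
        if r.headD 0 = 0 then r.tail else lin (p.headD 0) (-r.headD 0) r.tail p.tail) + 1

/-- The value of an integer row, read as a linear form, at a vector. -/
def dot {n : ℕ} (r : List ℤ) (x : Fin n → ℂ) : ℂ := ∑ i : Fin n, (r.getD i 0 : ℂ) * x i

theorem dot_succ {n : ℕ} (r : List ℤ) (x : Fin (n + 1) → ℂ) :
    dot r x = (r.headD 0 : ℂ) * x 0 + dot r.tail (Fin.tail x) := by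
  rw [dot, Fin.sum_univ_succ]
  cases r <;> simp [dot, Fin.tail]

theorem dot_lin {n : ℕ} (a b : ℤ) (r s : List ℤ) (x : Fin n → ℂ) :
    dot (lin a b r s) x = a * dot r x + b * dot s x := by
  simp only [dot, getD_lin, Finset.mul_sum, ← Finset.sum_add_distrib]
  refine Finset.sum_congr rfl fun i _ => ?_
  push_cast
  ring

/-- The solution space of the homogeneous linear system with the given integer rows. -/
def sol (n : ℕ) (rows : List (List ℤ)) : Submodule ℂ (Fin n → ℂ) where
  carrier := {x | ∀ r ∈ rows, dot r x = 0}
  add_mem' hx hy r hr := by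
    have := hx r hr
    have := hy r hr
    simp_all [dot, mul_add, Finset.sum_add_distrib]
  zero_mem' r _ := by simp [dot]
  smul_mem' c x hx r hr := by
    have : dot r (c • x) = c * dot r x := by
      simp [dot, Finset.mul_sum, mul_left_comm]
    rw [this, hx r hr, mul_zero]

theorem mem_sol {n : ℕ} {rows : List (List ℤ)} {x : Fin n → ℂ} :
    x ∈ sol n rows ↔ ∀ r ∈ rows, dot r x = 0 := Iff.rfl

theorem finrank_sol_add_elim (n : ℕ) (rows : List (List ℤ)) :
    Module.finrank ℂ (sol n rows) + elim n rows = n := by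
  induction n generalizing rows with
  | zero => simp [elim, Module.finrank_zero_of_subsingleton]
  | succ n ih =>
    rw [elim]
    split
    · rename_i h
      have hhead : ∀ r ∈ rows, r.headD 0 = 0 := by simpa using h
      have e : sol (n + 1) rows ≃ₗ[ℂ] ℂ × sol n (rows.map List.tail) :=
        { toFun x := (x.1 0, ⟨Fin.tail x.1, by
            intro r hr
            obtain ⟨s, hs, rfl⟩ := List.mem_map.1 hr
            have := x.2 s hs
            rwa [dot_succ, hhead s hs, Int.cast_zero, zero_mul, zero_add] at this⟩)
          invFun y := ⟨Fin.cons y.1 y.2.1, fun r hr => by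
            rw [dot_succ, hhead r hr, Int.cast_zero, zero_mul, zero_add, Fin.tail_cons]
            exact y.2.2 _ (List.mem_map_of_mem hr)⟩
          map_add' _ _ := rfl
          map_smul' _ _ := rfl
          left_inv x := by simp
          right_inv y := by simp }
      rw [e.finrank_eq, Module.finrank_prod, Module.finrank_self]
      have := ih (rows.map List.tail)
      omega
    · rename_i p h
      have hp : p ∈ rows := List.mem_of_find?_eq_some h
      have hp0 : (p.headD 0 : ℂ) ≠ 0 := by
        have := List.find?_some h
        exact_mod_cast by simpa using this
      set rows' := rows.map fun r =>
        if r.headD 0 = 0 then r.tail else lin (p.headD 0) (-r.headD 0) r.tail p.tail with hrows'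
      have hmem : ∀ x : Fin (n + 1) → ℂ, dot p x = 0 →
          (x ∈ sol (n + 1) rows ↔ Fin.tail x ∈ sol n rows') := by
        intro x hx
        rw [dot_succ] at hx
        simp only [mem_sol, hrows', List.forall_mem_map]
        refine forall₂_congr fun r _ => ?_
        rw [dot_succ]
        split_ifs with hr
        · rw [hr, Int.cast_zero, zero_mul, zero_add]
        · rw [dot_lin, ← mul_right_inj' hp0, mul_zero, Int.cast_neg]
          refine Eq.congr_left ?_
          linear_combination (r.headD 0 : ℂ) * hx
      have e : sol (n + 1) rows ≃ₗ[ℂ] sol n rows' :=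
        { toFun x := ⟨Fin.tail x.1, (hmem x.1 (x.2 p hp)).1 x.2⟩
          invFun y :=
            let x : Fin (n + 1) → ℂ := Fin.cons (-dot p.tail y.1 / p.headD 0) y.1
            ⟨x, (hmem x (by
              rw [dot_succ, show x 0 = -dot p.tail y.1 / p.headD 0 from rfl,
                show Fin.tail x = y.1 from rfl, mul_div_cancel₀ _ hp0, neg_add_cancel])).2 (by simp [x])⟩
          map_add' _ _ := rfl
          map_smul' _ _ := rfl
          left_inv x := by
            have := x.2 p hp
            rw [dot_succ] at this
            ext i
            refine Fin.cases ?_ (fun i => ?_) i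
            · simp only [Fin.cons_zero]
              rw [div_eq_iff hp0]
              linear_combination -this
            · rfl
          right_inv y := by simp }
      rw [e.finrank_eq, ← add_assoc, ih]

end IntRows

namespace G2

/-- `br i j = (N, m)` encodes the bracket `⁅e i, e j⁆ = N • e m` of root vectors. -/
def br (i j : Fin 6) : ℤ × Fin 6 :=
  match i, j with
  | 0, 1 => (-1, 2) | 1, 0 => (1, 2)
  | 1, 2 => (2, 3)  | 2, 1 => (-2, 3)
  | 1, 3 => (3, 4)  | 3, 1 => (-3, 4)
  | 0, 4 => (1, 5)  | 4, 0 => (-1, 5)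
  | 2, 3 => (-3, 5) | 3, 2 => (3, 5)
  | _, _ => (0, 0)

/-- Signed insertion of an index into an increasing list; the sign is `0` if the index
already occurs. -/
def ins (a : Fin 6) : List (Fin 6) → ℤ × List (Fin 6)
  | [] => (1, [a])
  | b :: l => if a < b then (1, a :: b :: l) else if a = b then (0, a :: b :: l) else
      (-(ins a l).1, b :: (ins a l).2)

/-- Signed insertion sort; the sign is `0` if an index is repeated. -/
def srt : List (Fin 6) → ℤ × List (Fin 6)
  | [] => (1, [])
  | a :: l => ((srt l).1 * (ins a (srt l).2).1, (ins a (srt l).2).2)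

/-- The value of `du` on the root vectors indexed by `s`, in coordinate `b`, as a formal
linear combination of the coordinates of `u`. -/
def terms (s : List (Fin 6)) (b : Fin 6) : List (ℤ × List (Fin 6) × Fin 6) :=
  (((List.range s.length).flatMap fun i => (List.finRange 6).map fun a =>
    (if (br (s.getD i 0) a).2 = b then (-1) ^ i * (br (s.getD i 0) a).1 else 0,
      s.eraseIdx i, a)) ++
  ((List.range s.length).flatMap fun j => (List.range s.length).map fun i =>
    let t := srt ((s.eraseIdx j).set i (br (s.getD i 0) (s.getD j 0)).2)
    (if i < j then if (br (s.getD i 0) (s.getD j 0)).1 = 0 then 0 else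
      (-1) ^ j * (br (s.getD i 0) (s.getD j 0)).1 * t.1 else 0,
      t.2, b))).filter fun t => t.1 ≠ 0

/-- The coordinates of `k`-cochains. -/
def cols (k : ℕ) : List (List (Fin 6) × Fin 6) :=
  (List.finRange 6).sublistsLen k ×ˢ List.finRange 6

/-- The row of coefficients of a formal linear combination of coordinates of `k`-cochains. -/
def dense (k : ℕ) (T : List (ℤ × List (Fin 6) × Fin 6)) : List ℤ :=
  (cols k).map fun c => ((T.filter fun t => t.2 = c).map Prod.fst).sum

/-- The matrix of the differential on `k`-cochains. -/
def mat (k : ℕ) : List (List ℤ) := (cols (k + 1)).map fun c => dense k (terms c.1 c.2)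

theorem length_ins (a : Fin 6) (l : List (Fin 6)) : (ins a l).2.length = l.length + 1 := by
  induction l with
  | nil => rfl
  | cons b l ih =>
    rw [ins]
    split_ifs <;> simp [ih]

theorem length_srt (l : List (Fin 6)) : (srt l).2.length = l.length := by
  induction l with
  | nil => rfl
  | cons a l ih => simp [srt, length_ins, ih]

theorem mem_ins {a c : Fin 6} {l : List (Fin 6)} (h : c ∈ (ins a l).2) : c = a ∨ c ∈ l := by
  induction l with
  | nil => simpa [ins] using h
  | cons b l ih =>
    rw [ins] at h
    split_ifs at h
    · simpa using h
    · simpa using h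
    · simp only [List.mem_cons] at h ⊢
      tauto

theorem pairwise_ins {a : Fin 6} {l : List (Fin 6)} (hl : l.Pairwise (· < ·))
    (h : (ins a l).1 ≠ 0) : (ins a l).2.Pairwise (· < ·) := by
  induction l with
  | nil => simp [ins]
  | cons b l ih =>
    rw [ins] at h ⊢
    rw [List.pairwise_cons] at hl
    split_ifs at h ⊢ with hab hab'
    · simp only [List.pairwise_cons, List.mem_cons]
      refine ⟨?_, hl⟩
      rintro c (rfl | hc)
      · exact hab
      · exact hab.trans (hl.1 c hc)
    · simp at h
    · rw [List.pairwise_cons]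
      refine ⟨fun c hc => ?_, ih hl.2 (by simpa using h)⟩
      rcases mem_ins hc with rfl | hc
      · exact lt_of_le_of_ne (not_lt.1 hab) (Ne.symm hab')
      · exact hl.1 c hc

theorem pairwise_srt {l : List (Fin 6)} (h : (srt l).1 ≠ 0) : (srt l).2.Pairwise (· < ·) := by
  induction l with
  | nil => simp [srt]
  | cons a l ih =>
    rw [srt] at h ⊢
    exact pairwise_ins (ih (left_ne_zero_of_mul h)) (right_ne_zero_of_mul h)

theorem mem_cols {k : ℕ} {c : List (Fin 6) × Fin 6} :
    c ∈ cols k ↔ c.1.Pairwise (· < ·) ∧ c.1.length = k := by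
  have hsub : ∀ l : List (Fin 6), l.Sublist (List.finRange 6) ↔ l.Pairwise (· < ·) := fun l => by
    refine ⟨fun h => (List.pairwise_lt_finRange 6).sublist h, fun h => ?_⟩
    exact List.sublist_of_subperm_of_pairwise
      (List.Nodup.subperm (h.imp ne_of_lt) fun a _ => List.mem_finRange a) h (List.pairwise_lt_finRange 6)
  obtain ⟨l, a⟩ := c
  simp [cols, List.mem_sublistsLen, hsub]

theorem nodup_cols (k : ℕ) : (cols k).Nodup :=
  (List.nodup_sublistsLen k (List.nodup_finRange 6)).product (List.nodup_finRange 6)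

theorem length_cols (k : ℕ) : (cols k).length = Nat.choose 6 k * 6 := by
  simp [cols, List.length_product]

theorem mem_cols_of_mem_terms {k : ℕ} {c : List (Fin 6) × Fin 6} (hc : c ∈ cols (k + 1))
    {t : ℤ × List (Fin 6) × Fin 6} (ht : t ∈ terms c.1 c.2) : t.2 ∈ cols k := by
  rw [mem_cols] at hc ⊢
  obtain ⟨ht, ht0⟩ := List.mem_filter.1 ht
  rcases List.mem_append.1 ht with ht | ht
  · simp only [List.mem_flatMap, List.mem_map, List.mem_range] at ht
    obtain ⟨i, hi, a, -, rfl⟩ := ht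
    refine ⟨hc.1.sublist (List.eraseIdx_sublist _ _), ?_⟩
    rw [List.length_eraseIdx, if_pos hi, hc.2, Nat.add_sub_cancel]
  · simp only [List.mem_flatMap, List.mem_map, List.mem_range] at ht
    obtain ⟨j, hj, i, hi, rfl⟩ := ht
    refine ⟨pairwise_srt ?_, ?_⟩
    · intro h
      simp only [h, mul_zero, ite_self, ne_eq, not_true_eq_false, decide_false,
        Bool.false_eq_true] at ht0
    · simp only [length_srt, List.length_set]
      rw [List.length_eraseIdx, if_pos hj, hc.2, Nat.add_sub_cancel]

/-- The value of a formal linear combination of coordinates. -/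
def value (X : List (Fin 6) × Fin 6 → ℂ) (T : List (ℤ × List (Fin 6) × Fin 6)) : ℂ :=
  (T.map fun t => (t.1 : ℂ) * X t.2).sum

theorem dot_dense {k : ℕ} (X : List (Fin 6) × Fin 6 → ℂ) {T : List (ℤ × List (Fin 6) × Fin 6)}
    (hT : ∀ t ∈ T, t.2 ∈ cols k) :
    IntRows.dot (dense k T) (fun i : Fin (cols k).length => X (cols k)[i]) = value X T := by
  have hdot : ∀ T, IntRows.dot (dense k T) (fun i : Fin (cols k).length => X (cols k)[i]) =
      ∑ i : Fin (cols k).length,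
        (((T.filter fun t => t.2 = (cols k)[i]).map Prod.fst).sum : ℂ) * X (cols k)[i] := by
    intro T
    simp [IntRows.dot, dense, List.getD_eq_getElem?_getD]
  induction T with
  | nil =>
    rw [hdot]
    simp [value]
  | cons t T ih =>
    obtain ⟨i, hi, ht⟩ := List.mem_iff_getElem.1 (hT t List.mem_cons_self)
    have hsingle : ∀ j : Fin (cols k).length, t.2 = (cols k)[j] ↔ j = ⟨i, hi⟩ := fun j => by
      rw [← ht, Fin.ext_iff]
      exact ((nodup_cols k).getElem_inj_iff).trans eq_comm
    rw [value, List.map_cons, List.sum_cons, ← value,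
      ← ih fun s hs => hT s (List.mem_cons_of_mem t hs), hdot, hdot]
    have hfilter : ∀ j : Fin (cols k).length,
        ((((t :: T).filter fun t => t.2 = (cols k)[j]).map Prod.fst).sum : ℤ) =
          (if j = ⟨i, hi⟩ then t.1 else 0) +
            ((T.filter fun t => t.2 = (cols k)[j]).map Prod.fst).sum := fun j => by
      rw [List.filter_cons]
      simp only [decide_eq_true_eq, hsingle]
      split_ifs <;> simp
    simp only [hfilter, Int.cast_add, add_mul, Finset.sum_add_distrib]
    congr 1
    rw [Finset.sum_eq_single ⟨i, hi⟩]
    · simp [ht]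
    · intro j _ hj
      simp [hj]
    · simp

end G2

namespace G2

variable {L : Type*} [LieRing L] [LieAlgebra ℂ L]

/-- The tuple of basis vectors indexed by a list. -/
noncomputable def tup (e : Module.Basis (Fin 6) ℂ L) (k : ℕ) (l : List (Fin 6)) : Fin k → L :=
  fun i => e (l.getD i 0)

/-- The coordinate `c.2` of the value of a cochain on the basis vectors indexed by `c.1`. -/
noncomputable def coord (e : Module.Basis (Fin 6) ℂ L) {k : ℕ} (u : L [⋀^Fin k]→ₗ[ℂ] L)
    (c : List (Fin 6) × Fin 6) : ℂ :=
  e.repr (u (tup e k c.1)) c.2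

variable (e : Module.Basis (Fin 6) ℂ L) {k : ℕ} (u : L [⋀^Fin k]→ₗ[ℂ] L)

theorem map_tup_swap (p l : List (Fin 6)) (a b : Fin 6) (hk : p.length + l.length + 2 = k) :
    u (tup e k (p ++ a :: b :: l)) = -u (tup e k (p ++ b :: a :: l)) := by
  have hne : (⟨p.length, by omega⟩ : Fin k) ≠ ⟨p.length + 1, by omega⟩ := by simp
  rw [← u.map_swap _ hne]
  congr 1
  funext i
  simp only [tup, Function.comp_apply]
  congr 1
  rcases lt_trichotomy (i : ℕ) p.length with hi | hi | hi
  · rw [Equiv.swap_apply_of_ne_of_ne]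
    · rw [List.getD_append _ _ _ _ hi, List.getD_append _ _ _ _ hi]
    · simp [Fin.ext_iff, hi.ne]
    · simp [Fin.ext_iff]; omega
  · rw [show i = ⟨p.length, by omega⟩ from Fin.ext hi, Equiv.swap_apply_left]
    simp
  · obtain ⟨n, hn⟩ := Nat.exists_eq_add_of_lt hi
    cases n with
    | zero =>
      rw [show i = ⟨p.length + 1, by omega⟩ from Fin.ext hn, Equiv.swap_apply_right]
      simp
    | succ n =>
      rw [Equiv.swap_apply_of_ne_of_ne]
      · rw [List.getD_append_right _ _ _ _ hi.le, List.getD_append_right _ _ _ _ hi.le,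
          show (i : ℕ) - p.length = n + 2 by omega]
        rfl
      · simp [Fin.ext_iff]; omega
      · simp [Fin.ext_iff]; omega

theorem map_tup_self (p l : List (Fin 6)) (a : Fin 6) (hk : p.length + l.length + 2 = k) :
    u (tup e k (p ++ a :: a :: l)) = 0 := by
  refine u.map_eq_zero_of_eq _ (i := ⟨p.length, by omega⟩) (j := ⟨p.length + 1, by omega⟩) ?_
    (by simp)
  simp [tup]

theorem map_tup_ins (p l : List (Fin 6)) (a : Fin 6) (hk : p.length + l.length + 1 = k) :
    u (tup e k (p ++ a :: l)) = ((ins a l).1 : ℂ) • u (tup e k (p ++ (ins a l).2)) := by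
  induction l generalizing p with
  | nil => simp [ins]
  | cons b l ih =>
    rw [List.length_cons] at hk
    rw [ins]
    split_ifs with hab hab'
    · simp
    · rw [hab', map_tup_self e u p l b (by omega)]
      simp
    · rw [map_tup_swap e u p l a b (by omega)]
      have := ih (p ++ [b]) (by simp; omega)
      simp only [List.append_assoc, List.singleton_append] at this
      rw [this, Int.cast_neg, neg_smul]

theorem map_tup_srt (p l : List (Fin 6)) (hk : p.length + l.length = k) :
    u (tup e k (p ++ l)) = ((srt l).1 : ℂ) • u (tup e k (p ++ (srt l).2)) := by
  induction l generalizing p with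
  | nil => simp [srt]
  | cons a l ih =>
    rw [List.length_cons] at hk
    have := ih (p ++ [a]) (by simp; omega)
    simp only [List.append_assoc, List.singleton_append] at this
    rw [this, map_tup_ins e u p _ a (by rw [length_srt]; omega), smul_smul, srt, Int.cast_mul]

theorem coord_srt (l : List (Fin 6)) (a : Fin 6) (hk : l.length = k) :
    coord e u (l, a) = (srt l).1 * coord e u ((srt l).2, a) := by
  have := map_tup_srt e u [] l (by simpa using hk)
  simp only [List.nil_append] at this
  simp [coord, this]

theorem eq_zero_of_coord_eq_zero (hu : ∀ c ∈ cols k, coord e u c = 0) : u = 0 := by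
  refine Module.Basis.ext_alternating e fun v _ => ?_
  have hv : (fun i => e (v i)) = tup e k (List.ofFn v) := by
    funext i
    simp [tup]
  rw [AlternatingMap.zero_apply, hv]
  refine e.ext_elem fun a => ?_
  rw [map_zero, Finsupp.zero_apply]
  change coord e u (List.ofFn v, a) = 0
  rw [coord_srt e u _ _ List.length_ofFn]
  by_cases h : (srt (List.ofFn v)).1 = 0
  · rw [h, Int.cast_zero, zero_mul]
  · rw [hu _ (mem_cols.2 ⟨pairwise_srt h, by simp [length_srt]⟩), mul_zero]

/-- The coordinates of a `k`-cochain, as a linear equivalence. -/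
theorem exists_coordEquiv (k : ℕ) :
    ∃ Φ : (L [⋀^Fin k]→ₗ[ℂ] L) ≃ₗ[ℂ] (Fin (cols k).length → ℂ),
      ∀ u, Φ u = fun i : Fin (cols k).length => coord e u (cols k)[i] := by
  have := Module.Finite.of_basis e
  have := CE.finite_cochains L k
  let Φ : (L [⋀^Fin k]→ₗ[ℂ] L) →ₗ[ℂ] (Fin (cols k).length → ℂ) :=
    { toFun u i := coord e u (cols k)[i]
      map_add' u v := by
        funext i
        simp [coord]
      map_smul' c u := by
        funext i
        simp [coord] }
  have hinj : Function.Injective Φ := by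
    rw [injective_iff_map_eq_zero]
    intro u hu
    refine eq_zero_of_coord_eq_zero e u fun c hc => ?_
    obtain ⟨i, hi, rfl⟩ := List.mem_iff_getElem.1 hc
    exact congrFun hu ⟨i, hi⟩
  have hdim : Module.finrank ℂ (L [⋀^Fin k]→ₗ[ℂ] L) =
      Module.finrank ℂ (Fin (cols k).length → ℂ) := by
    rw [CE.finrank_cochains, Module.finrank_eq_card_basis e, Module.finrank_fin_fun, length_cols,
      Fintype.card_fin]
  exact ⟨LinearEquiv.ofInjectiveOfFinrankEq Φ hinj hdim, fun u => rfl⟩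

theorem br_symm (i j : Fin 6) : br j i = (-(br i j).1, (br i j).2) := by
  revert i j
  decide

theorem lie_e (h : G2NilradicalBasis L) (i j : Fin 6) :
    ⁅h.e i, h.e j⁆ = ((br i j).1 : ℂ) • h.e (br i j).2 := by
  have hlt : ∀ i j : Fin 6, i < j → ⁅h.e i, h.e j⁆ = ((br i j).1 : ℂ) • h.e (br i j).2 := by
    intro i j hij
    fin_cases i <;> fin_cases j <;> first
      | exact absurd hij (by decide)
      | simp [br, h.lie_01, h.lie_02, h.lie_03, h.lie_04, h.lie_05, h.lie_12, h.lie_13,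
          h.lie_14, h.lie_15, h.lie_23, h.lie_24, h.lie_25, h.lie_34, h.lie_35, h.lie_45]
  rcases lt_trichotomy i j with hij | rfl | hij
  · exact hlt i j hij
  · have : (br i i).1 = 0 := by
      revert i
      decide
    simp [this]
  · rw [← lie_skew, hlt j i hij, br_symm j i, Int.cast_neg, neg_smul]

theorem value_append (X : List (Fin 6) × Fin 6 → ℂ) (S T : List (ℤ × List (Fin 6) × Fin 6)) :
    value X (S ++ T) = value X S + value X T := by
  simp [value]

theorem value_flatMap {α : Type*} (X : List (Fin 6) × Fin 6 → ℂ) (l : List α)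
    (f : α → List (ℤ × List (Fin 6) × Fin 6)) :
    value X (l.flatMap f) = (l.map fun a => value X (f a)).sum := by
  induction l with
  | nil => rfl
  | cons a l ih => rw [List.flatMap_cons, value_append, ih, List.map_cons, List.sum_cons]

theorem value_filter (X : List (Fin 6) × Fin 6 → ℂ) (T : List (ℤ × List (Fin 6) × Fin 6)) :
    value X (T.filter fun t => t.1 ≠ 0) = value X T := by
  induction T with
  | nil => rfl
  | cons t T ih =>
    by_cases ht : t.1 = 0
    · rw [List.filter_cons_of_neg (by simpa using ht), ih]
      simp [value, ht]
    · rw [List.filter_cons_of_pos (by simpa using ht)]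
      simpa [value] using ih

theorem sum_map_range (n : ℕ) (f : ℕ → ℂ) : ((List.range n).map f).sum = ∑ i : Fin n, f i := by
  rw [← Finset.sum_range]
  rfl

theorem removeNth_tup (l : List (Fin 6)) (i : Fin (k + 1)) :
    i.removeNth (tup e (k + 1) l) = tup e k (l.eraseIdx i) := by
  funext j
  simp only [Fin.removeNth, tup, List.getD_eq_getElem?_getD, List.getElem?_eraseIdx]
  congr 2
  rcases lt_or_ge (j : ℕ) i with h | h
  · rw [Fin.succAbove_of_castSucc_lt _ _ h, if_pos h, Fin.val_castSucc]
  · rw [Fin.succAbove_of_le_castSucc _ _ h, if_neg h.not_gt, Fin.val_succ]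

theorem update_tup (l : List (Fin 6)) (i : Fin k) (hi : i < l.length) (a : Fin 6) :
    Function.update (tup e k l) i (e a) = tup e k (l.set i a) := by
  funext j
  rcases eq_or_ne j i with rfl | hj
  · simp [tup, hi]
  · rw [Function.update_of_ne hj]
    simp [tup, List.getElem?_set_ne (Fin.val_ne_of_ne hj.symm)]

theorem repr_lie (h : G2NilradicalBasis L) (i b : Fin 6) (w : L) :
    h.e.repr ⁅h.e i, w⁆ b =
      ∑ a, (if (br i a).2 = b then ((br i a).1 : ℂ) else 0) * h.e.repr w a := by
  conv_lhs => rw [← h.e.sum_repr w]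
  simp only [lie_sum, lie_smul, lie_e h, map_sum, map_smul, Finsupp.coe_finsetSum,
    Finset.sum_apply, Finsupp.smul_apply, smul_eq_mul, Module.Basis.repr_self]
  refine Finset.sum_congr rfl fun a _ => ?_
  rw [Finsupp.single_apply]
  split_ifs <;> ring

/-- The coordinates of `du` are given by the formal linear combinations `terms`. -/
theorem coord_ceDiff (h : G2NilradicalBasis L) {c : List (Fin 6) × Fin 6}
    (hc : c.1.length = k + 1) :
    coord h.e (CE.ceDiff k u) c = value (coord h.e u) (terms c.1 c.2) := by
  obtain ⟨l, b⟩ := c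
  simp only at hc
  rw [coord, CE.ceDiff_apply, CE.ceDiffFun, terms, value_filter, value_append, value_flatMap,
    value_flatMap, map_add, Finsupp.add_apply, hc, sum_map_range, sum_map_range, map_sum, map_sum,
    Finsupp.finsetSum_apply, Finsupp.finsetSum_apply]
  congr 1
  · refine Finset.sum_congr rfl fun i _ => ?_
    rw [removeNth_tup, map_smul, Finsupp.smul_apply, tup, repr_lie, value, List.map_map,
      Fin.sum_univ_def, smul_eq_mul, ← List.sum_map_mul_left]
    congr 1
    refine List.map_congr_left fun a _ => ?_
    simp only [Function.comp_apply, coord]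
    split_ifs <;> push_cast <;> ring
  · refine Finset.sum_congr rfl fun j _ => ?_
    rw [map_sum, Finsupp.finsetSum_apply, value, List.map_map, sum_map_range]
    refine Finset.sum_congr rfl fun i _ => ?_
    simp only [Function.comp_apply]
    split_ifs with hij hN
    · rw [removeNth_tup, tup, tup, lie_e h, hN, u.map_update_smul]
      simp
    · have hlen : (l.eraseIdx j).length = k := by
        rw [List.length_eraseIdx, if_pos (by omega), hc, Nat.add_sub_cancel]
      rw [removeNth_tup, tup, tup, lie_e h, u.map_update_smul, update_tup _ _ _ (by simp; omega)]
      have := coord_srt h.e u ((l.eraseIdx j).set i (br (l.getD i 0) (l.getD j 0)).2) b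
        (by rw [List.length_set, hlen])
      rw [coord] at this
      rw [map_smul, map_smul, Finsupp.smul_apply, Finsupp.smul_apply, this]
      simp only [smul_eq_mul]
      push_cast
      ring
    · simp

theorem finrank_ker_ceDiff (h : G2NilradicalBasis L) (k : ℕ) :
    Module.finrank ℂ (LinearMap.ker (CE.ceDiff (L := L) k)) +
      IntRows.elim (cols k).length (mat k) = (cols k).length := by
  obtain ⟨Φ, hΦ⟩ := exists_coordEquiv h.e k
  have hker : (LinearMap.ker (CE.ceDiff (L := L) k)).map Φ.toLinearMap =
      IntRows.sol (cols k).length (mat k) := by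
    ext x
    obtain ⟨u, rfl⟩ := Φ.surjective x
    have hrow : ∀ c ∈ cols (k + 1), IntRows.dot (dense k (terms c.1 c.2)) (Φ u) =
        coord h.e (CE.ceDiff k u) c := fun c hc => by
      rw [hΦ, dot_dense _ fun t ht => mem_cols_of_mem_terms hc ht,
        coord_ceDiff u h (mem_cols.1 hc).2]
    have hsol : Φ u ∈ IntRows.sol (cols k).length (mat k) ↔
        ∀ c ∈ cols (k + 1), coord h.e (CE.ceDiff k u) c = 0 := by
      simp only [IntRows.mem_sol, mat, List.forall_mem_map]
      exact forall₂_congr fun c hc => by rw [hrow c hc]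
    rw [hsol]
    simp only [Submodule.mem_map, LinearEquiv.coe_coe, EmbeddingLike.apply_eq_iff_eq,
      exists_eq_right, LinearMap.mem_ker]
    refine ⟨fun hu c _ => by simp [hu, coord], eq_zero_of_coord_eq_zero h.e _⟩
  have hsum := IntRows.finrank_sol_add_elim (cols k).length (mat k)
  rwa [← hker, LinearEquiv.finrank_map_eq] at hsum

/-- The formal linear combination for the coordinates of `ddu`. -/
def terms₂ (c : List (Fin 6) × Fin 6) : List (ℤ × List (Fin 6) × Fin 6) :=
  (terms c.1 c.2).flatMap fun t => (terms t.2.1 t.2.2).map fun s => (t.1 * s.1, s.2)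

theorem range_le_ker (h : G2NilradicalBasis L) (k : ℕ)
    (hdd : ∀ c ∈ cols (k + 2), ∀ t ∈ terms₂ c,
      (((terms₂ c).filter fun s => s.2 = t.2).map Prod.fst).sum = 0) :
    LinearMap.range (CE.ceDiff (L := L) k) ≤ LinearMap.ker (CE.ceDiff (L := L) (k + 1)) := by
  rintro _ ⟨u, rfl⟩
  refine eq_zero_of_coord_eq_zero h.e _ fun c hc => ?_
  have hmem : ∀ t ∈ terms₂ c, t.2 ∈ cols k := fun t ht => by
    simp only [terms₂, List.mem_flatMap, List.mem_map] at ht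
    obtain ⟨t', ht', s, hs, rfl⟩ := ht
    have := mem_cols_of_mem_terms (mem_cols_of_mem_terms hc ht') hs
    exact this
  have hval : coord h.e (CE.ceDiff (k + 1) (CE.ceDiff k u)) c =
      value (coord h.e u) (terms₂ c) := by
    rw [coord_ceDiff _ h (mem_cols.1 hc).2, terms₂, value_flatMap, value]
    congr 1
    refine List.map_congr_left fun t ht => ?_
    rw [coord_ceDiff u h (mem_cols.1 (mem_cols_of_mem_terms hc ht)).2, value, value,
      ← List.sum_map_mul_left, List.map_map]
    congr 1
    refine List.map_congr_left fun s _ => ?_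
    simp [mul_assoc]
  rw [hval, ← dot_dense _ hmem, IntRows.dot]
  refine Finset.sum_eq_zero fun i _ => ?_
  have hi : (dense k (terms₂ c)).getD i 0 =
      (((terms₂ c).filter fun t => t.2 = (cols k)[i]).map Prod.fst).sum := by
    simp [dense, List.getD_eq_getElem?_getD]
  rw [hi]
  by_cases hT : (terms₂ c).filter (fun t => t.2 = (cols k)[i]) = []
  · rw [hT, List.map_nil, List.sum_nil, Int.cast_zero, zero_mul]
  · obtain ⟨t, ht⟩ := List.exists_mem_of_ne_nil _ hT
    obtain ⟨ht, hti⟩ := List.mem_filter.1 ht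
    rw [← of_decide_eq_true hti, hdd c hc t ht, Int.cast_zero, zero_mul]

theorem elim_mat :
    IntRows.elim (cols 0).length (mat 0) = 5 ∧ IntRows.elim (cols 1).length (mat 1) = 27 ∧
    IntRows.elim (cols 2).length (mat 2) = 56 ∧ IntRows.elim (cols 3).length (mat 3) = 56 ∧
    IntRows.elim (cols 4).length (mat 4) = 27 ∧ IntRows.elim (cols 5).length (mat 5) = 4 ∧
    IntRows.elim (cols 6).length (mat 6) = 0 := by
  decide +kernel

theorem sum_filter_terms₂_eq_zero :
    ∀ k < 6, ∀ c ∈ cols (k + 2), ∀ t ∈ terms₂ c,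
      (((terms₂ c).filter fun s => s.2 = t.2).map Prod.fst).sum = 0 := by
  decide +kernel

theorem finrank_Hsucc (h : G2NilradicalBasis L) {k r s : ℕ} (hk : k < 6)
    (hr : IntRows.elim (cols k).length (mat k) = r)
    (hs : IntRows.elim (cols (k + 1)).length (mat (k + 1)) = s) :
    Module.finrank ℂ (CE.Hsucc L k) + r + s = Nat.choose 6 (k + 1) * 6 := by
  have := Module.Finite.of_basis h.e
  have hH := CE.finrank_Hsucc_add_finrank_cochains L k
    (range_le_ker h k (sum_filter_terms₂_eq_zero k hk))
  rw [CE.finrank_cochains, Module.finrank_eq_card_basis h.e, Fintype.card_fin] at hH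
  have h₁ := finrank_ker_ceDiff h k
  have h₂ := finrank_ker_ceDiff h (k + 1)
  rw [hr, length_cols] at h₁
  rw [hs, length_cols] at h₂
  omega

end G2

/-- For `𝔤` the simple complex Lie algebra of type `G₂` and `𝔫` its
6-dimensional maximal nilpotent subalgebra, the adjoint Chevalley–Eilenberg cohomology
has dimensions `dim H⁰(𝔫;𝔫) = 1`, `dim H¹(𝔫;𝔫) = 4`, `dim H²(𝔫;𝔫) = 7`,
`dim H³(𝔫;𝔫) = 8`, `dim H⁴(𝔫;𝔫) = 7`, `dim H⁵(𝔫;𝔫) = 5`, `dim H⁶(𝔫;𝔫) = 2`. -/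
theorem g2_nilradical_adjoint_cohomology_dims
    (L : Type*) [LieRing L] [LieAlgebra ℂ L] (h : G2NilradicalBasis L) :
    Module.finrank ℂ (CE.H0 L) = 1 ∧
    Module.finrank ℂ (CE.Hsucc L 0) = 4 ∧
    Module.finrank ℂ (CE.Hsucc L 1) = 7 ∧
    Module.finrank ℂ (CE.Hsucc L 2) = 8 ∧
    Module.finrank ℂ (CE.Hsucc L 3) = 7 ∧
    Module.finrank ℂ (CE.Hsucc L 4) = 5 ∧
    Module.finrank ℂ (CE.Hsucc L 5) = 2 := by
  obtain ⟨h₀, h₁, h₂, h₃, h₄, h₅, h₆⟩ := G2.elim_mat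
  have hZ := G2.finrank_ker_ceDiff h 0
  rw [h₀, G2.length_cols, ← CE.cocycles_eq_ker] at hZ
  refine ⟨Nat.add_right_cancel hZ, ?_, ?_, ?_, ?_, ?_, ?_⟩
  · exact Nat.add_right_cancel (Nat.add_right_cancel (G2.finrank_Hsucc h (by norm_num) h₀ h₁))
  · exact Nat.add_right_cancel (Nat.add_right_cancel (G2.finrank_Hsucc h (by norm_num) h₁ h₂))
  · exact Nat.add_right_cancel (Nat.add_right_cancel (G2.finrank_Hsucc h (by norm_num) h₂ h₃))
  · exact Nat.add_right_cancel (Nat.add_right_cancel (G2.finrank_Hsucc h (by norm_num) h₃ h₄))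
  · exact Nat.add_right_cancel (Nat.add_right_cancel (G2.finrank_Hsucc h (by norm_num) h₄ h₅))
  · exact Nat.add_right_cancel (Nat.add_right_cancel (G2.finrank_Hsucc h (by norm_num) h₅ h₆))
end

section
/- For the 3-dimensional complex Heisenberg Lie algebra 𝔫, the five 2-cochains h²₁ = y⊗f^x∧f^z, h²₂ = −y⊗f^y∧f^z + x⊗f^x∧f^z, h²₃ = y⊗f^y∧f^x − z⊗f^x∧f^z, h²₄ = x⊗f^y∧f^z, h²₅ = x⊗f^y∧f^x + z⊗f^y∧f^z (where f^x, f^y, f^z is the basis dual to x, y, z) are Chevalley–Eilenberg cocycles in C²(𝔫;𝔫) whose classes form a basis of H²(𝔫;𝔫); and for χ = k₁h²₁ + k₂h²₂ + k₃h²₃ + k₄h²₄ + k₅h²₅, the class of the Nijenhuis–Richardson square [χ,χ] = 2 χ·χ in H³(𝔫;𝔫) vanishes if and only if k₁k₅ − k₂k₃ = 0 and k₂k₅ + k₃k₄ = 0. -/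
namespace NR

variable {L : Type*} [LieRing L] [LieAlgebra ℂ L]

/-- A permutation `σ` of `{0, …, N−1}` is a shuffle with cut `q`: it is strictly
increasing on the first `q` positions and on the remaining `N − q` positions. -/
def IsShuffle {N : ℕ} (q : ℕ) (σ : Equiv.Perm (Fin N)) : Prop :=
  ∀ i j : Fin N, i < j → ((j : ℕ) < q ∨ q ≤ (i : ℕ)) → σ i < σ j

open Classical in
/-- The Nijenhuis–Richardson product of cochains (written here for arbitrary functions on
tuples): for `a ∈ C^{p+1}` and `b ∈ C^{q+1}`,
`(a·b)(x₁,…,x_{p+q+1}) = Σ_σ sgn(σ) a(b(x_{σ(1)},…,x_{σ(q+1)}), x_{σ(q+2)},…,x_{σ(p+q+1)})`,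
the sum being over all `(q+1, p)`-shuffles `σ`. -/
noncomputable def prod {k l : ℕ} (f : (Fin (k + 1) → L) → L) (g : (Fin (l + 1) → L) → L) :
    (Fin (k + l + 1) → L) → L := fun x =>
  ∑ σ : Equiv.Perm (Fin (k + l + 1)),
    if IsShuffle (l + 1) σ then
      ((Equiv.Perm.sign σ : ℤ) : ℂ) •
        f (Fin.cons (g fun i : Fin (l + 1) => x (σ ⟨i, by have := i.isLt; omega⟩))
            fun j : Fin k => x (σ ⟨l + 1 + (j : ℕ), by have := j.isLt; omega⟩))
    else 0

/-- The Nijenhuis–Richardson (super)bracket `[a, b] = a·b − (−1)^{p(a)p(b)} b·a` on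
`Π(C^{•+1}(𝔫;𝔫))`, where `a ∈ C^{p+1}` has parity `p(a) = p (mod 2)`. -/
noncomputable def bracket {k l : ℕ} (f : (Fin (k + 1) → L) → L)
    (g : (Fin (l + 1) → L) → L) : (Fin (k + l + 1) → L) → L := fun x =>
  prod f g x -
    ((-1 : ℂ) ^ (k * l)) • prod g f (fun i : Fin (l + k + 1) => x (Fin.cast (by omega) i))

end NR

/-- The 3-dimensional complex Heisenberg Lie algebra: a complex Lie algebra with a basis
`x = b 0`, `y = b 1`, `z = b 2` whose only nonzero bracket among basis vectors is
`⁅x, y⁆ = z`.  This is the maximal nilpotent subalgebra of `𝔰𝔩(3, ℂ)`. -/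
structure HeisenbergBasis (L : Type*) [LieRing L] [LieAlgebra ℂ L] where
  /-- the basis `x, y, z` -/
  b : Module.Basis (Fin 3) ℂ L
  lie_x_y : ⁅b 0, b 1⁆ = b 2
  lie_x_z : ⁅b 0, b 2⁆ = 0
  lie_y_z : ⁅b 1, b 2⁆ = 0

namespace NR

variable {L : Type*} [LieRing L] [LieAlgebra ℂ L]

/-- The Nijenhuis–Richardson product of two binary cochains. -/
theorem prod_apply_of_binary (f g : (Fin (1 + 1) → L) → L) (v : Fin (1 + 1 + 1) → L) :
    prod f g v = f ![g ![v 0, v 1], v 2] - f ![g ![v 0, v 2], v 1]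
      + f ![g ![v 1, v 2], v 0] := by
  have key (τ : Equiv.Perm (Fin (1 + 1 + 1))) :
      f (Fin.cons (g fun i : Fin (1 + 1) => v (τ ⟨i, by have := i.isLt; omega⟩))
          fun j : Fin 1 => v (τ ⟨1 + 1 + (j : ℕ), by have := j.isLt; omega⟩))
        = f ![g ![v (τ 0), v (τ 1)], v (τ 2)] := by
    have h1 : (fun i : Fin (1 + 1) => v (τ ⟨i, by have := i.isLt; omega⟩))
        = ![v (τ 0), v (τ 1)] := by
      funext i; fin_cases i <;> rfl
    rw [h1]
    congr 1
    funext i; fin_cases i <;> rfl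
  have hs (τ : Equiv.Perm (Fin (1 + 1 + 1))) :
      IsShuffle (1 + 1) τ ↔ τ ∈ ({1, Equiv.swap 1 2, finRotate 3} :
        Finset (Equiv.Perm (Fin (1 + 1 + 1)))) := by
    unfold IsShuffle
    revert τ
    decide
  unfold prod
  simp only [key, hs]
  rw [Finset.sum_ite_mem, Finset.univ_inter, Finset.sum_insert (by decide),
    Finset.sum_insert (by decide), Finset.sum_singleton]
  have e1 : Equiv.Perm.sign (Equiv.swap (1 : Fin (1 + 1 + 1)) 2) = -1 := by decide
  have e2 : Equiv.Perm.sign (finRotate 3 : Equiv.Perm (Fin (1 + 1 + 1))) = 1 := by decide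
  have r0 : (finRotate 3 : Equiv.Perm (Fin (1 + 1 + 1))) 0 = 1 := by decide
  have r1 : (finRotate 3 : Equiv.Perm (Fin (1 + 1 + 1))) 1 = 2 := by decide
  have r2 : (finRotate 3 : Equiv.Perm (Fin (1 + 1 + 1))) 2 = 0 := by decide
  have s0 : Equiv.swap (1 : Fin (1 + 1 + 1)) 2 0 = 0 := by decide
  rw [e1, e2, r0, r1, r2, s0, Equiv.swap_apply_left, Equiv.swap_apply_right]
  simp
  abel

end NR

namespace CE

variable {L : Type*} [LieRing L] [LieAlgebra ℂ L]

theorem ceDiffFun_one_apply (c : (Fin 1 → L) → L) (v : Fin 2 → L) :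
    ceDiffFun c v = ⁅v 0, c ![v 1]⁆ - ⁅v 1, c ![v 0]⁆ - c ![⁅v 0, v 1⁆] := by
  have r0 : (0 : Fin 2).removeNth v = ![v 1] := by funext i; fin_cases i; rfl
  have r1 : (1 : Fin 2).removeNth v = ![v 0] := by funext i; fin_cases i; rfl
  have u1 : Function.update ![v 0] 0 ⁅v 0, v 1⁆ = ![⁅v 0, v 1⁆] := by
    funext i; fin_cases i; rfl
  have h : ceDiffFun c v = (∑ i : Fin 2, (-1 : ℂ) ^ (i : ℕ) • ⁅v i, c (i.removeNth v)⁆) +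
      ∑ j : Fin 2, ∑ i : Fin 2, if h : (i : ℕ) < (j : ℕ) then (-1 : ℂ) ^ (j : ℕ) •
        c (Function.update (j.removeNth v)
          ⟨(i : ℕ), h.trans_le (Nat.lt_succ_iff.mp j.isLt)⟩ ⁅v i, v j⁆) else 0 := rfl
  rw [h]
  simp only [Fin.sum_univ_two, r0, r1]
  rw [dif_neg (by decide), dif_neg (by decide), dif_pos (by decide), dif_neg (by decide)]
  change (-1 : ℂ) ^ 0 • _ + (-1 : ℂ) ^ 1 • _ +
    (0 + 0 + ((-1 : ℂ) ^ 1 • c (Function.update ![v 0] 0 ⁅v 0, v 1⁆) + 0)) = _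
  rw [u1]
  module

theorem ceDiffFun_two_apply (c : (Fin 2 → L) → L) (v : Fin 3 → L) :
    ceDiffFun c v = ⁅v 0, c ![v 1, v 2]⁆ - ⁅v 1, c ![v 0, v 2]⁆ + ⁅v 2, c ![v 0, v 1]⁆
      - c ![⁅v 0, v 1⁆, v 2] + c ![⁅v 0, v 2⁆, v 1] + c ![v 0, ⁅v 1, v 2⁆] := by
  have r0 : (0 : Fin 3).removeNth v = ![v 1, v 2] := by funext i; fin_cases i <;> rfl
  have r1 : (1 : Fin 3).removeNth v = ![v 0, v 2] := by funext i; fin_cases i <;> rfl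
  have r2 : (2 : Fin 3).removeNth v = ![v 0, v 1] := by funext i; fin_cases i <;> rfl
  have u0 (a b w : L) : Function.update ![a, b] 0 w = ![w, b] := by
    funext i; fin_cases i <;> rfl
  have u1 (a b w : L) : Function.update ![a, b] 1 w = ![a, w] := by
    funext i; fin_cases i <;> rfl
  have h : ceDiffFun c v = (∑ i : Fin 3, (-1 : ℂ) ^ (i : ℕ) • ⁅v i, c (i.removeNth v)⁆) +
      ∑ j : Fin 3, ∑ i : Fin 3, if h : (i : ℕ) < (j : ℕ) then (-1 : ℂ) ^ (j : ℕ) •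
        c (Function.update (j.removeNth v)
          ⟨(i : ℕ), h.trans_le (Nat.lt_succ_iff.mp j.isLt)⟩ ⁅v i, v j⁆) else 0 := rfl
  rw [h]
  simp only [Fin.sum_univ_three, r0, r1, r2]
  rw [dif_neg (by decide), dif_neg (by decide), dif_neg (by decide),
    dif_pos (by decide), dif_neg (by decide), dif_neg (by decide),
    dif_pos (by decide), dif_pos (by decide), dif_neg (by decide)]
  change (-1 : ℂ) ^ 0 • _ + (-1 : ℂ) ^ 1 • _ + (-1 : ℂ) ^ 2 • _ +
    (0 + 0 + 0 + ((-1 : ℂ) ^ 1 • c (Function.update ![v 0, v 2] 0 ⁅v 0, v 1⁆) + 0 + 0) +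
      ((-1 : ℂ) ^ 2 • c (Function.update ![v 0, v 1] 0 ⁅v 0, v 2⁆) +
        (-1 : ℂ) ^ 2 • c (Function.update ![v 0, v 1] 1 ⁅v 1, v 2⁆) + 0)) = _
  rw [u0, u0, u1]
  module

end CE

namespace HeisenbergBasis

variable {L : Type*} [LieRing L] [LieAlgebra ℂ L] (hb : HeisenbergBasis L)

theorem eq_sum_repr (a : L) :
    a = hb.b.repr a 0 • hb.b 0 + hb.b.repr a 1 • hb.b 1 + hb.b.repr a 2 • hb.b 2 := by
  conv_lhs => rw [← hb.b.sum_repr a, Fin.sum_univ_three]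

theorem lie_eq_smul (a c : L) :
    ⁅a, c⁆ = (hb.b.repr a 0 * hb.b.repr c 1 - hb.b.repr a 1 * hb.b.repr c 0) • hb.b 2 := by
  have hyx : ⁅hb.b 1, hb.b 0⁆ = -hb.b 2 := by rw [← lie_skew, hb.lie_x_y]
  have hzx : ⁅hb.b 2, hb.b 0⁆ = 0 := by rw [← lie_skew, hb.lie_x_z, neg_zero]
  have hzy : ⁅hb.b 2, hb.b 1⁆ = 0 := by rw [← lie_skew, hb.lie_y_z, neg_zero]
  conv_lhs => rw [hb.eq_sum_repr a, hb.eq_sum_repr c]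
  simp only [lie_add, add_lie, lie_smul, smul_lie, lie_self, hb.lie_x_y, hb.lie_x_z,
    hb.lie_y_z, hyx, hzx, hzy, smul_zero]
  module

theorem alternatingMap_two_apply (c : AlternatingMap ℂ L L (Fin 2)) (a d : L) :
    c ![a, d] =
      (hb.b.repr a 0 * hb.b.repr d 1 - hb.b.repr a 1 * hb.b.repr d 0) • c ![hb.b 0, hb.b 1]
      + (hb.b.repr a 0 * hb.b.repr d 2 - hb.b.repr a 2 * hb.b.repr d 0) • c ![hb.b 0, hb.b 2]
      + (hb.b.repr a 1 * hb.b.repr d 2 - hb.b.repr a 2 * hb.b.repr d 1) •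
        c ![hb.b 1, hb.b 2] := by
  have addl (p q r : L) : c ![p + q, r] = c ![p, r] + c ![q, r] :=
    c.map_vecCons_add ![r] p q
  have smull (t : ℂ) (p r : L) : c ![t • p, r] = t • c ![p, r] :=
    c.map_vecCons_smul ![r] t p
  have swap (p q : L) : c ![p, q] = -c ![q, p] := by
    have h := c.map_swap ![q, p] (show (0 : Fin 2) ≠ 1 by decide)
    rw [← h]
    congr 1
    funext i; fin_cases i <;> rfl
  have self (p : L) : c ![p, p] = 0 :=
    c.map_eq_zero_of_eq ![p, p] (i := 0) (j := 1) rfl (by decide)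
  have addr (p q r : L) : c ![r, p + q] = c ![r, p] + c ![r, q] := by
    rw [swap, addl, swap r p, swap r q, neg_add]
  have smulr (t : ℂ) (p r : L) : c ![r, t • p] = t • c ![r, p] := by
    rw [swap, smull, swap r p, smul_neg]
  conv_lhs => rw [hb.eq_sum_repr a, hb.eq_sum_repr d]
  simp only [addl, addr, smull, smulr, self, swap (hb.b 1) (hb.b 0), swap (hb.b 2) (hb.b 0),
    swap (hb.b 2) (hb.b 1)]
  module

/-- The linear conditions cutting out the 2-coboundaries. -/
theorem repr_of_mem_coboundaries {c : AlternatingMap ℂ L L (Fin 2)}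
    (hc : c ∈ CE.coboundaries L 1) :
    hb.b.repr (c ![hb.b 0, hb.b 2]) 0 = 0 ∧ hb.b.repr (c ![hb.b 0, hb.b 2]) 1 = 0 ∧
    hb.b.repr (c ![hb.b 1, hb.b 2]) 0 = 0 ∧
    hb.b.repr (c ![hb.b 0, hb.b 1]) 0 = hb.b.repr (c ![hb.b 1, hb.b 2]) 2 ∧
    hb.b.repr (c ![hb.b 0, hb.b 1]) 1 = -hb.b.repr (c ![hb.b 0, hb.b 2]) 2 := by
  unfold CE.coboundaries at hc
  induction hc using Submodule.span_induction with
  | mem c h =>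
    obtain ⟨u, hu⟩ := h
    have hz : u ![0] = 0 := u.map_coord_zero 0 rfl
    simp [hu, CE.ceDiffFun_one_apply, hb.lie_eq_smul, hz]
  | zero => simp
  | add a d _ _ ha hd =>
    obtain ⟨a1, a2, a3, a4, a5⟩ := ha
    obtain ⟨d1, d2, d3, d4, d5⟩ := hd
    simp [a1, a2, a3, a4, a5, d1, d2, d3, d4, d5]
    ring
  | smul t a _ ha =>
    obtain ⟨a1, a2, a3, a4, a5⟩ := ha
    simp [a1, a2, a3, a4, a5]

/-- The linear conditions of `repr_of_mem_coboundaries` and the cocycle condition suffice for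
a 2-cochain to be a coboundary. -/
theorem mem_coboundaries_of_repr {c : AlternatingMap ℂ L L (Fin 2)}
    (h1 : hb.b.repr (c ![hb.b 0, hb.b 2]) 0 = 0) (h2 : hb.b.repr (c ![hb.b 0, hb.b 2]) 1 = 0)
    (h3 : hb.b.repr (c ![hb.b 1, hb.b 2]) 0 = 0) (h4 : hb.b.repr (c ![hb.b 1, hb.b 2]) 1 = 0)
    (h5 : hb.b.repr (c ![hb.b 0, hb.b 1]) 0 = hb.b.repr (c ![hb.b 1, hb.b 2]) 2)
    (h6 : hb.b.repr (c ![hb.b 0, hb.b 1]) 1 = -hb.b.repr (c ![hb.b 0, hb.b 2]) 2) :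
    c ∈ CE.coboundaries L 1 := by
  refine Submodule.subset_span
    ⟨AlternatingMap.ofSubsingleton ℂ L L 0 (-(hb.b.coord 2).smulRight (c ![hb.b 0, hb.b 1])),
      fun v => ?_⟩
  have hv : v = ![v 0, v 1] := by funext i; fin_cases i <;> rfl
  rw [CE.ceDiffFun_one_apply]
  conv_lhs => rw [hv, hb.alternatingMap_two_apply]
  refine hb.b.ext_elem fun i => ?_
  fin_cases i <;> simp [hb.lie_eq_smul, h1, h2, h3, h4, h5, h6]
  ring

/-- The differential of a 2-cochain is a multiple of the determinant form, with values in the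
centre. -/
theorem ceDiffFun_two_eq (c : AlternatingMap ℂ L L (Fin 2)) (v : Fin 3 → L) :
    CE.ceDiffFun c v =
      (hb.b.det v * (hb.b.repr (c ![hb.b 1, hb.b 2]) 1 + hb.b.repr (c ![hb.b 0, hb.b 2]) 0)) •
        hb.b 2 := by
  rw [CE.ceDiffFun_two_apply, Module.Basis.det_apply, Matrix.det_fin_three]
  simp only [hb.alternatingMap_two_apply c (v _), hb.alternatingMap_two_apply c ⁅_, _⁆,
    Module.Basis.toMatrix_apply]
  refine hb.b.ext_elem fun i => ?_
  fin_cases i <;> simp [hb.lie_eq_smul] <;> ring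

/-- The square of a 2-cochain is determined by its value on the basis. -/
theorem prod_self_eq (c : AlternatingMap ℂ L L (Fin 2)) (v : Fin 3 → L) :
    NR.prod c c v = hb.b.det v • NR.prod c c hb.b := by
  rw [NR.prod_apply_of_binary, NR.prod_apply_of_binary, Module.Basis.det_apply,
    Matrix.det_fin_three]
  simp only [Module.Basis.toMatrix_apply, hb.alternatingMap_two_apply c (v _) (v _)]
  simp only [hb.alternatingMap_two_apply c (_ + _), hb.alternatingMap_two_apply c (c _),
    map_add, map_smul, Finsupp.add_apply, Finsupp.smul_apply, smul_eq_mul]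
  simp
  module

theorem prod_self_basis (c : AlternatingMap ℂ L L (Fin 2)) :
    NR.prod c c hb.b =
      (hb.b.repr (c ![hb.b 0, hb.b 1]) 0 - hb.b.repr (c ![hb.b 1, hb.b 2]) 2) •
        c ![hb.b 0, hb.b 2] +
      (hb.b.repr (c ![hb.b 0, hb.b 1]) 1 + hb.b.repr (c ![hb.b 0, hb.b 2]) 2) •
        c ![hb.b 1, hb.b 2] -
      (hb.b.repr (c ![hb.b 0, hb.b 2]) 0 + hb.b.repr (c ![hb.b 1, hb.b 2]) 1) •
        c ![hb.b 0, hb.b 1] := by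
  rw [NR.prod_apply_of_binary]
  simp only [hb.alternatingMap_two_apply c (c _)]
  simp
  module

/-- The obstruction to exactness of the square of a cocycle in the span of the standard
representatives of the second cohomology. -/
theorem prod_self_exact_iff {c : AlternatingMap ℂ L L (Fin 2)} {k : Fin 5 → ℂ}
    (h1 : c ![hb.b 0, hb.b 1] = -(k 4 • hb.b 0) - k 2 • hb.b 1)
    (h2 : c ![hb.b 0, hb.b 2] = k 1 • hb.b 0 + k 0 • hb.b 1 - k 2 • hb.b 2)
    (h3 : c ![hb.b 1, hb.b 2] = k 3 • hb.b 0 - k 1 • hb.b 1 + k 4 • hb.b 2) :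
    (∃ u : AlternatingMap ℂ L L (Fin 2), ∀ v : Fin 3 → L,
        NR.prod c c v + NR.prod c c v = CE.ceDiffFun u v) ↔
      (k 0 * k 4 - k 1 * k 2 = 0 ∧ k 1 * k 4 + k 2 * k 3 = 0) := by
  constructor
  · rintro ⟨u, hu⟩
    have h := hu hb.b
    rw [hb.ceDiffFun_two_eq, hb.prod_self_basis] at h
    have hx := congrArg (fun a => hb.b.repr a 0) h
    have hy := congrArg (fun a => hb.b.repr a 1) h
    simp only [h1, h2, h3] at hx hy
    simp at hx hy
    constructor <;> grind
  · rintro ⟨e1, e2⟩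
    have hsq : NR.prod c c hb.b = 0 := by
      rw [hb.prod_self_basis]
      simp only [h1, h2, h3]
      refine hb.b.ext_elem fun i => ?_
      fin_cases i <;> simp <;> grind
    refine ⟨0, fun v => ?_⟩
    rw [hb.ceDiffFun_two_eq, hb.prod_self_eq, hsq, smul_zero, add_zero]
    simp

end HeisenbergBasis

/-- For the 3-dimensional complex Heisenberg Lie algebra `𝔫`, the five
2-cochains
`h²₁ = y⊗f^x∧f^z`, `h²₂ = −y⊗f^y∧f^z + x⊗f^x∧f^z`, `h²₃ = y⊗f^y∧f^x − z⊗f^x∧f^z`,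
`h²₄ = x⊗f^y∧f^z`, `h²₅ = x⊗f^y∧f^x + z⊗f^y∧f^z`
(where `f^x, f^y, f^z` is the basis dual to `x, y, z`) are Chevalley–Eilenberg cocycles
in `C²(𝔫;𝔫)` whose classes form a basis of `H²(𝔫;𝔫)`; and for
`χ = k₁h²₁ + k₂h²₂ + k₃h²₃ + k₄h²₄ + k₅h²₅`, the class of the Nijenhuis–Richardson
square `[χ,χ] = 2 χ·χ` in `H³(𝔫;𝔫)` vanishes if and only if
`k₁k₅ − k₂k₃ = 0` and `k₂k₅ + k₃k₄ = 0`. -/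
theorem heisenberg_H2_basis_and_homologic_squares
    (L : Type*) [LieRing L] [LieAlgebra ℂ L] (hb : HeisenbergBasis L)
    (x y z : L) (hx : x = hb.b 0) (hy : y = hb.b 1) (hz : z = hb.b 2)
    (fx fy fz : L →ₗ[ℂ] ℂ)
    (hfx : fx = hb.b.coord 0) (hfy : fy = hb.b.coord 1) (hfz : fz = hb.b.coord 2)
    (h2 : Fin 5 → AlternatingMap ℂ L L (Fin 2))
    (hh1 : ∀ u : Fin 2 → L,
      h2 0 u = (fx (u 0) * fz (u 1) - fx (u 1) * fz (u 0)) • y)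
    (hh2 : ∀ u : Fin 2 → L,
      h2 1 u = -((fy (u 0) * fz (u 1) - fy (u 1) * fz (u 0)) • y) +
        (fx (u 0) * fz (u 1) - fx (u 1) * fz (u 0)) • x)
    (hh3 : ∀ u : Fin 2 → L,
      h2 2 u = (fy (u 0) * fx (u 1) - fy (u 1) * fx (u 0)) • y -
        (fx (u 0) * fz (u 1) - fx (u 1) * fz (u 0)) • z)
    (hh4 : ∀ u : Fin 2 → L,
      h2 3 u = (fy (u 0) * fz (u 1) - fy (u 1) * fz (u 0)) • x)
    (hh5 : ∀ u : Fin 2 → L,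
      h2 4 u = (fy (u 0) * fx (u 1) - fy (u 1) * fx (u 0)) • x +
        (fy (u 0) * fz (u 1) - fy (u 1) * fz (u 0)) • z) :
    -- the `h²ᵢ` are cocycles
    (∀ i : Fin 5, ∀ u, CE.ceDiffFun (⇑(h2 i)) u = 0) ∧
    -- their classes are linearly independent modulo coboundaries …
    LinearIndependent ℂ (fun i : Fin 5 =>
      (Submodule.Quotient.mk (h2 i) :
        AlternatingMap ℂ L L (Fin 2) ⧸ CE.coboundaries L 1)) ∧
    -- … and every 2-cocycle is a combination of them modulo coboundaries,
    -- so they form a basis of `H²(𝔫;𝔫)`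
    (∀ c : AlternatingMap ℂ L L (Fin 2), (∀ u, CE.ceDiffFun ⇑c u = 0) →
      (Submodule.Quotient.mk c :
          AlternatingMap ℂ L L (Fin 2) ⧸ CE.coboundaries L 1) ∈
        Submodule.span ℂ (Set.range fun i : Fin 5 =>
          (Submodule.Quotient.mk (h2 i) :
            AlternatingMap ℂ L L (Fin 2) ⧸ CE.coboundaries L 1))) ∧
    -- the class of `[χ,χ] = 2 χ·χ` in `H³(𝔫;𝔫)` vanishes iff the two quadratic
    -- equations hold
    (∀ k : Fin 5 → ℂ,
      ((∃ u : AlternatingMap ℂ L L (Fin 2), ∀ v : Fin 3 → L,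
          NR.prod (⇑(∑ i, k i • h2 i)) (⇑(∑ i, k i • h2 i)) v +
            NR.prod (⇑(∑ i, k i • h2 i)) (⇑(∑ i, k i • h2 i)) v =
          CE.ceDiffFun ⇑u v) ↔
        (k 0 * k 4 - k 1 * k 2 = 0 ∧ k 1 * k 4 + k 2 * k 3 = 0))) := by
  subst hx hy hz hfx hfy hfz
  have hval (k : Fin 5 → ℂ) (u : Fin 2 → L) : (∑ i, k i • h2 i) u =
      k 0 • h2 0 u + k 1 • h2 1 u + k 2 • h2 2 u + k 3 • h2 3 u + k 4 • h2 4 u := by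
    simp [Fin.sum_univ_five]
  have hxy (k : Fin 5 → ℂ) : (∑ i, k i • h2 i) ![hb.b 0, hb.b 1] =
      -(k 4 • hb.b 0) - k 2 • hb.b 1 := by
    rw [hval, hh1, hh2, hh3, hh4, hh5]
    simp
    abel
  have hxz (k : Fin 5 → ℂ) : (∑ i, k i • h2 i) ![hb.b 0, hb.b 2] =
      k 1 • hb.b 0 + k 0 • hb.b 1 - k 2 • hb.b 2 := by
    rw [hval, hh1, hh2, hh3, hh4, hh5]
    simp
    abel
  have hyz (k : Fin 5 → ℂ) : (∑ i, k i • h2 i) ![hb.b 1, hb.b 2] =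
      k 3 • hb.b 0 - k 1 • hb.b 1 + k 4 • hb.b 2 := by
    rw [hval, hh1, hh2, hh3, hh4, hh5]
    simp
    abel
  refine ⟨fun i u => ?_, ?_, fun c hc => ?_,
    fun k => hb.prod_self_exact_iff (hxy k) (hxz k) (hyz k)⟩
  · rw [hb.ceDiffFun_two_eq]
    fin_cases i <;> simp [hh1, hh2, hh3, hh4, hh5]
  · rw [Fintype.linearIndependent_iff]
    intro g hg
    simp only [← Submodule.mkQ_apply, ← map_smul, ← map_sum] at hg
    rw [Submodule.mkQ_apply, Submodule.Quotient.mk_eq_zero] at hg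
    have h := hb.repr_of_mem_coboundaries hg
    simp only [hxy, hxz, hyz] at h
    simp at h
    obtain ⟨a1, a2, a3, a4, a5⟩ := h
    intro i
    fin_cases i <;> simp <;> grind
  · have hcoc := congrArg (fun a => hb.b.repr a 2)
      ((hb.ceDiffFun_two_eq c hb.b).symm.trans (hc hb.b))
    simp [hb.b.det_self] at hcoc
    set A := hb.b.repr (c ![hb.b 0, hb.b 1]) with hA
    set B := hb.b.repr (c ![hb.b 0, hb.b 2]) with hB
    set C := hb.b.repr (c ![hb.b 1, hb.b 2]) with hC
    let k : Fin 5 → ℂ := ![B 1, B 0, -(A 1 + B 2) / 2, C 0, (C 2 - A 0) / 2]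
    have hmem : c - ∑ i, k i • h2 i ∈ CE.coboundaries L 1 := by
      apply hb.mem_coboundaries_of_repr <;>
        simp only [AlternatingMap.sub_apply, hxy, hxz, hyz, map_sub,
          Finsupp.sub_apply, ← hA, ← hB, ← hC] <;>
        simp [k] <;> grind
    rw [(Submodule.Quotient.eq _).2 hmem, Submodule.mem_span_range_iff_exists_fun]
    refine ⟨k, ?_⟩
    simp only [← Submodule.mkQ_apply, map_sum, map_smul]
end
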